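/- Let d ≥ 3, α ∈ (max(0, d-4), d-2), and γ = α + 3 - d ∈ (-1,1). For every μ ∈ C_c^∞(ℝ^d;ℝ), writing 𝒦 = 𝒦_{μ,α}, the following identity holds: ∬_{ℝ^d×(0,∞)} ξ^γ |∇²_{(x,ξ)} 𝒦(x,ξ)|² dx dξ = (1 - γ/4) ∬_{ℝ^d×(0,∞)} ξ^γ |Δ_γ 𝒦(x,ξ)|² dx dξ, where |∇²_{(x,ξ)} 𝒦|² denotes the squared Frobenius norm of the full Hessian of 𝒦 in all d+1 variables. -/

import Mathlib

open MeasureTheory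

noncomputable section

/-- The operator `Δ_γ f = Δ_{(x,ξ)} f + (γ/ξ) ∂_ξ f` on functions on `ℝ^d × ℝ`
(relevant on the upper half-space `ξ > 0`). -/
noncomputable def dgamma (d : ℕ) (γ : ℝ)
    (f : EuclideanSpace ℝ (Fin d) × ℝ → ℝ)
    (p : EuclideanSpace ℝ (Fin d) × ℝ) : ℝ :=
  (∑ i : Fin d,
      fderiv ℝ (fun q => fderiv ℝ f q (EuclideanSpace.single i 1, 0)) p
        (EuclideanSpace.single i 1, 0))
    + fderiv ℝ (fun q => fderiv ℝ f q (0, 1)) p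
        ((0 : EuclideanSpace ℝ (Fin d)), (1 : ℝ))
    + γ / p.2 * fderiv ℝ f p ((0 : EuclideanSpace ℝ (Fin d)), (1 : ℝ))

/-- The `d+1` coordinate directions of `ℝ^d × ℝ`. -/
noncomputable def dir (d : ℕ) (i : Fin (d + 1)) : EuclideanSpace ℝ (Fin d) × ℝ :=
  if h : (i : ℕ) < d then (EuclideanSpace.single (⟨i, h⟩ : Fin d) 1, 0)
  else ((0 : EuclideanSpace ℝ (Fin d)), (1 : ℝ))

/-- The squared Frobenius norm of the full Hessian (in all `d+1` variables)
of a function on `ℝ^d × ℝ`. -/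
noncomputable def hessSq (d : ℕ) (f : EuclideanSpace ℝ (Fin d) × ℝ → ℝ)
    (p : EuclideanSpace ℝ (Fin d) × ℝ) : ℝ :=
  ∑ i : Fin (d + 1), ∑ j : Fin (d + 1),
    (fderiv ℝ (fun q => fderiv ℝ f q (dir d j)) p (dir d i)) ^ 2

/-- The extended potential `𝒦_{μ,β}(x,ξ) = ∫ |(x-y,ξ)|^{-β} μ(y) dy` on the upper
half-space. -/
noncomputable def Kext (d : ℕ) (β : ℝ) (μ : EuclideanSpace ℝ (Fin d) → ℝ)
    (p : EuclideanSpace ℝ (Fin d) × ℝ) : ℝ :=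
  ∫ y, (‖p.1 - y‖ ^ 2 + p.2 ^ 2) ^ (-β / 2) * μ y

open Real Set Filter Topology
open scoped ContDiff

section HomogeneousKernels

variable {E : Type*} [NormedAddCommGroup E] [NormedSpace ℝ E]
  {F : Type*} [NormedAddCommGroup F] [NormedSpace ℝ F]

/-- Functions on `E × ℝ`, smooth away from the origin and positively homogeneous of
degree `-β`. -/
structure IsHomKernel (β : ℝ) (φ : E × ℝ → F) : Prop where
  contDiffOn : ContDiffOn ℝ ∞ φ {0}ᶜ
  homog : ∀ t : ℝ, 0 < t → ∀ p : E × ℝ, p ≠ 0 → φ (t • p) = t ^ (-β) • φ p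

/-- The derivative of `φ` in the constant direction `v`. -/
def dirDeriv (v : E × ℝ) (φ : E × ℝ → F) (p : E × ℝ) : F := fderiv ℝ φ p v

namespace IsHomKernel

variable {β : ℝ} {φ ψ : E × ℝ → F}

lemma of_eq {β' : ℝ} (h : IsHomKernel β φ) (e : β = β') : IsHomKernel β' φ := e ▸ h

lemma contDiffAt (h : IsHomKernel β φ) {p : E × ℝ} (hp : p ≠ 0) : ContDiffAt ℝ ∞ φ p :=
  h.contDiffOn.contDiffAt (isOpen_compl_singleton.mem_nhds hp)

lemma differentiableAt (h : IsHomKernel β φ) {p : E × ℝ} (hp : p ≠ 0) :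
    DifferentiableAt ℝ φ p :=
  (h.contDiffAt hp).differentiableAt (by simp)

lemma add (h : IsHomKernel β φ) (h' : IsHomKernel β ψ) :
    IsHomKernel β (fun p => φ p + ψ p) where
  contDiffOn := h.contDiffOn.add h'.contDiffOn
  homog t ht p hp := by rw [h.homog t ht p hp, h'.homog t ht p hp, smul_add]

lemma const_smul (h : IsHomKernel β φ) (c : ℝ) : IsHomKernel β (fun p => c • φ p) where
  contDiffOn := h.contDiffOn.const_smul c
  homog t ht p hp := by rw [h.homog t ht p hp, smul_comm]

lemma const_mul {φ : E × ℝ → ℝ} (h : IsHomKernel β φ) (c : ℝ) :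
    IsHomKernel β (fun p => c * φ p) := h.const_smul c

lemma sum {ι : Type*} (s : Finset ι) {φ : ι → E × ℝ → F} (h : ∀ i, IsHomKernel β (φ i)) :
    IsHomKernel β (fun p => ∑ i ∈ s, φ i p) where
  contDiffOn := ContDiffOn.sum fun i _ => (h i).contDiffOn
  homog t ht p hp := by
    rw [Finset.smul_sum]
    exact Finset.sum_congr rfl fun i _ => (h i).homog t ht p hp

lemma isHomKernel_fderiv (h : IsHomKernel β φ) : IsHomKernel (β + 1) (fderiv ℝ φ) where
  contDiffOn := h.contDiffOn.fderiv_of_isOpen isOpen_compl_singleton (by simp)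
  homog t ht p hp := by
    have htp : t • p ≠ 0 := smul_ne_zero ht.ne' hp
    have h1 : HasFDerivAt (fun q : E × ℝ => φ (t • q))
        ((fderiv ℝ φ (t • p)).comp (t • ContinuousLinearMap.id ℝ (E × ℝ))) p :=
      HasFDerivAt.comp p (h.differentiableAt htp).hasFDerivAt
        ((hasFDerivAt_id p).const_smul t)
    have h2 : HasFDerivAt (fun q : E × ℝ => φ (t • q)) (t ^ (-β) • fderiv ℝ φ p) p := by
      refine ((h.differentiableAt hp).hasFDerivAt.const_smul (t ^ (-β))).congr_of_eventuallyEq ?_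
      filter_upwards [isOpen_compl_singleton.mem_nhds hp] with q hq
      exact h.homog t ht q hq
    have h3 := h1.unique h2
    refine ContinuousLinearMap.ext fun v => ?_
    have h4 := congrArg (fun L : E × ℝ →L[ℝ] F => L v) h3
    simp only [ContinuousLinearMap.comp_apply, FunLike.coe_smul, Pi.smul_apply,
      ContinuousLinearMap.id_apply, map_smul] at h4
    have h5 : t ^ (-(β + 1)) = t⁻¹ * t ^ (-β) := by
      rw [neg_add, rpow_add ht, rpow_neg_one, mul_comm]
    rw [FunLike.coe_smul, Pi.smul_apply, h5, mul_smul, ← h4, inv_smul_smul₀ ht.ne']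

lemma isHomKernel_dirDeriv (h : IsHomKernel β φ) (v : E × ℝ) :
    IsHomKernel (β + 1) (dirDeriv v φ) where
  contDiffOn := h.isHomKernel_fderiv.contDiffOn.clm_apply contDiffOn_const
  homog t ht p hp := by
    simp only [dirDeriv, h.isHomKernel_fderiv.homog t ht p hp, FunLike.coe_smul, Pi.smul_apply]

lemma snd_mul {φ : E × ℝ → ℝ} (h : IsHomKernel β φ) :
    IsHomKernel (β - 1) (fun p => p.2 * φ p) where
  contDiffOn := contDiff_snd.contDiffOn.mul h.contDiffOn
  homog t ht p hp := by
    have h5 : t ^ (-(β - 1)) = t * t ^ (-β) := by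
      rw [neg_sub, sub_eq_add_neg, rpow_add ht, rpow_one]
    rw [h.homog t ht p hp, h5]
    simp only [Prod.smul_snd, smul_eq_mul]
    ring

lemma exists_bound [FiniteDimensional ℝ E] (h : IsHomKernel β φ) :
    ∃ C, 0 ≤ C ∧ ∀ p, p ≠ 0 → ‖φ p‖ ≤ C * ‖p‖ ^ (-β) := by
  have hc : ContinuousOn φ (Metric.sphere 0 1) :=
    h.contDiffOn.continuousOn.mono fun p hp => by
      rintro rfl
      simp at hp
  obtain ⟨C, hC⟩ := (isCompact_sphere (0 : E × ℝ) 1).exists_bound_of_continuousOn hc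
  refine ⟨max C 0, le_max_right _ _, fun p hp => ?_⟩
  have hp' : 0 < ‖p‖ := norm_pos_iff.2 hp
  have h1 := h.homog ‖p‖ hp' (‖p‖⁻¹ • p) (smul_ne_zero (inv_ne_zero hp'.ne') hp)
  rw [smul_inv_smul₀ hp'.ne'] at h1
  rw [h1, norm_smul, norm_of_nonneg (rpow_nonneg hp'.le _), mul_comm]
  gcongr
  refine (hC _ ?_).trans (le_max_left _ _)
  simp [norm_smul, hp'.ne']

lemma dirDeriv_comm (h : IsHomKernel β φ) (v w : E × ℝ) {p : E × ℝ} (hp : p ≠ 0) :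
    dirDeriv v (dirDeriv w φ) p = dirDeriv w (dirDeriv v φ) p := by
  have hs : IsSymmSndFDerivAt ℝ φ p :=
    (h.contDiffAt hp).isSymmSndFDerivAt (by
      rw [minSmoothness_of_isRCLikeNormedField]
      exact WithTop.coe_le_coe.2 le_top)
  have hd : DifferentiableAt ℝ (fderiv ℝ φ) p := h.isHomKernel_fderiv.differentiableAt hp
  have key : ∀ a b : E × ℝ, dirDeriv a (dirDeriv b φ) p
      = fderiv ℝ (fderiv ℝ φ) p a b := fun a b => by
    have := hd.hasFDerivAt.clm_apply (hasFDerivAt_const b p)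
    unfold dirDeriv
    rw [this.fderiv]
    simp
  rw [key, key, hs.eq]

end IsHomKernel

lemma dirDeriv_congr_of_eqOn {φ ψ : E × ℝ → F} {s : Set (E × ℝ)} (hs : IsOpen s)
    (h : EqOn φ ψ s) (v : E × ℝ) : EqOn (dirDeriv v φ) (dirDeriv v ψ) s := fun p hp => by
  unfold dirDeriv
  rw [(h.eventuallyEq_of_mem (hs.mem_nhds hp)).fderiv_eq]

end HomogeneousKernels

section RieszKernels

variable {E : Type*} [NormedAddCommGroup E] [InnerProductSpace ℝ E]

/-- The kernel `|(x,ξ)|^{-β}`. -/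
def rieszKernel (β : ℝ) (p : E × ℝ) : ℝ := (‖p.1‖ ^ 2 + p.2 ^ 2) ^ (-β / 2)

/-- The Euclidean inner product on `E × ℝ`. -/
def prodInner (p q : E × ℝ) : ℝ := inner ℝ p.1 q.1 + p.2 * q.2

omit [InnerProductSpace ℝ E] in
lemma normSq_add_sq_pos {p : E × ℝ} (hp : p ≠ 0) : 0 < ‖p.1‖ ^ 2 + p.2 ^ 2 := by
  rcases eq_or_ne p.1 0 with h | h
  · have h2 : p.2 ≠ 0 := fun h2 => hp (Prod.ext h h2)
    positivity
  · have := norm_pos_iff.2 h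
    positivity

lemma isHomKernel_rieszKernel (β : ℝ) : IsHomKernel β (rieszKernel (E := E) β) where
  contDiffOn := by
    unfold rieszKernel
    refine ContDiffOn.rpow_const_of_ne ?_ fun p hp => (normSq_add_sq_pos hp).ne'
    exact ((contDiff_fst.norm_sq ℝ).add (contDiff_snd.pow 2)).contDiffOn
  homog t ht p hp := by
    have h1 : ‖(t • p).1‖ ^ 2 + (t • p).2 ^ 2 = t ^ 2 * (‖p.1‖ ^ 2 + p.2 ^ 2) := by
      simp only [Prod.smul_fst, Prod.smul_snd, norm_smul, norm_of_nonneg ht.le, smul_eq_mul]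
      ring
    unfold rieszKernel
    rw [h1, mul_rpow (by positivity) (normSq_add_sq_pos hp).le, ← rpow_natCast, ← rpow_mul ht.le,
      smul_eq_mul]
    congr 2
    push_cast
    ring

omit [InnerProductSpace ℝ E] in
lemma rieszKernel_sub_two (β : ℝ) {p : E × ℝ} (hp : p ≠ 0) :
    rieszKernel β p = (‖p.1‖ ^ 2 + p.2 ^ 2) * rieszKernel (β + 2) p := by
  have h := normSq_add_sq_pos hp
  unfold rieszKernel
  rw [show -β / 2 = 1 + -(β + 2) / 2 by ring, rpow_add h, rpow_one]

lemma dirDeriv_rieszKernel (β : ℝ) (v : E × ℝ) {p : E × ℝ} (hp : p ≠ 0) :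
    dirDeriv v (rieszKernel β) p = -β * (prodInner p v * rieszKernel (β + 2) p) := by
  have h1 : HasFDerivAt (fun q : E × ℝ => ‖q.1‖ ^ 2 + q.2 ^ 2)
      (((2 : ℝ) • (innerSL ℝ p.1).comp (ContinuousLinearMap.fst ℝ E ℝ))
        + (2 * p.2) • ContinuousLinearMap.snd ℝ E ℝ) p := by
    have ha := (hasFDerivAt_fst (𝕜 := ℝ) (E := E) (F := ℝ) (p := p)).norm_sq
    have hb := (hasFDerivAt_snd (𝕜 := ℝ) (E := E) (F := ℝ) (p := p)).pow 2
    refine (ha.add hb).congr_fderiv ?_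
    simp [two_smul, two_mul]
  have h2 := h1.rpow_const (p := -β / 2) (Or.inl (normSq_add_sq_pos hp).ne')
  unfold dirDeriv rieszKernel prodInner
  rw [h2.fderiv]
  have e : -β / 2 - 1 = -(β + 2) / 2 := by ring
  simp only [e, FunLike.coe_smul, Pi.smul_apply, FunLike.coe_add, Pi.add_apply,
    ContinuousLinearMap.comp_apply, ContinuousLinearMap.coe_fst', ContinuousLinearMap.coe_snd',
    innerSL_apply_apply, smul_eq_mul]
  ring

lemma dirDeriv_dirDeriv_rieszKernel (β : ℝ) (v w : E × ℝ) {p : E × ℝ} (hp : p ≠ 0) :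
    dirDeriv w (dirDeriv v (rieszKernel β)) p = -β * (prodInner w v * rieszKernel (β + 2) p)
      + β * (β + 2) * (prodInner p v * prodInner p w * rieszKernel (β + 4) p) := by
  rw [dirDeriv_congr_of_eqOn isOpen_compl_singleton
    (ψ := fun q => -β * (prodInner q v * rieszKernel (β + 2) q))
    (fun q hq => dirDeriv_rieszKernel β v hq) w hp]
  have h1 : HasFDerivAt (fun q : E × ℝ => prodInner q v)
      ((innerSL ℝ v.1).comp (ContinuousLinearMap.fst ℝ E ℝ)
        + v.2 • ContinuousLinearMap.snd ℝ E ℝ) p := by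
    have : (fun q : E × ℝ => prodInner q v) = ((innerSL ℝ v.1).comp (ContinuousLinearMap.fst ℝ E ℝ)
        + v.2 • ContinuousLinearMap.snd ℝ E ℝ : E × ℝ →L[ℝ] ℝ) := by
      ext q
      simp [prodInner, real_inner_comm, mul_comm]
    rw [this]
    exact ContinuousLinearMap.hasFDerivAt _
  have h2 := ((isHomKernel_rieszKernel (E := E) (β + 2)).differentiableAt hp).hasFDerivAt
  have h3 := (h1.fun_mul h2).const_mul (-β)
  have h4 := dirDeriv_rieszKernel (β + 2) w hp
  have e : β + 2 + 2 = β + 4 := by ring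
  rw [e] at h4
  unfold dirDeriv at h4 ⊢
  rw [h3.fderiv]
  simp only [FunLike.coe_smul, Pi.smul_apply, FunLike.coe_add, Pi.add_apply,
    ContinuousLinearMap.comp_apply, ContinuousLinearMap.coe_fst', ContinuousLinearMap.coe_snd',
    innerSL_apply_apply, smul_eq_mul, h4]
  have e2 : prodInner w v = inner ℝ v.1 w.1 + v.2 * w.2 := by
    simp [prodInner, real_inner_comm, mul_comm]
  rw [e2]
  ring

end RieszKernels

section Potentials

variable {E : Type*} [NormedAddCommGroup E] [NormedSpace ℝ E] [FiniteDimensional ℝ E]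
  [MeasureSpace E] [BorelSpace E] [(volume : Measure E).IsAddHaarMeasure]
  {F : Type*} [NormedAddCommGroup F] [NormedSpace ℝ F]

/-- The potential of the density `μ` with kernel `φ`, as a function on the upper half-space. -/
def potential (μ : E → ℝ) (φ : E × ℝ → ℝ) (p : E × ℝ) : ℝ := ∫ y, φ (p.1 - y, p.2) * μ y

omit [NormedSpace ℝ E] [FiniteDimensional ℝ E] [MeasureSpace E] [BorelSpace E]
  [(volume : Measure E).IsAddHaarMeasure] in
lemma ne_zero_of_snd_pos {p : E × ℝ} (hp : 0 < p.2) : p ≠ 0 := by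
  rintro rfl
  simp at hp

omit [NormedSpace ℝ E] [FiniteDimensional ℝ E] [MeasureSpace E] [BorelSpace E]
  [(volume : Measure E).IsAddHaarMeasure] in
lemma isOpen_upperHalf : IsOpen {p : E × ℝ | 0 < p.2} := isOpen_lt continuous_const continuous_snd

variable {μ : E → ℝ} {β : ℝ}

omit [FiniteDimensional ℝ E] [MeasureSpace E] [BorelSpace E]
  [(volume : Measure E).IsAddHaarMeasure] in
lemma IsHomKernel.continuous_translate {φ : E × ℝ → F} (h : IsHomKernel β φ) {p : E × ℝ}
    (hp : 0 < p.2) : Continuous fun y : E => φ (p.1 - y, p.2) :=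
  h.contDiffOn.continuousOn.comp_continuous (by fun_prop)
    fun y => ne_zero_of_snd_pos (p := (p.1 - y, p.2)) hp

omit [FiniteDimensional ℝ E] in
lemma IsHomKernel.integrable_translate {φ : E × ℝ → F} (h : IsHomKernel β φ)
    (hμ : Continuous μ) (hμs : HasCompactSupport μ) {p : E × ℝ} (hp : 0 < p.2) :
    Integrable fun y : E => μ y • φ (p.1 - y, p.2) :=
  (hμ.smul (h.continuous_translate hp)).integrable_of_hasCompactSupport hμs.smul_right

lemma IsHomKernel.hasFDerivAt_potential {φ : E × ℝ → ℝ} (h : IsHomKernel β φ) (hβ : 0 ≤ β)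
    (hμ : Continuous μ) (hμs : HasCompactSupport μ) {p : E × ℝ} (hp : 0 < p.2) :
    HasFDerivAt (potential μ φ) (∫ y, μ y • fderiv ℝ φ (p.1 - y, p.2)) p := by
  obtain ⟨C, hC, hbd⟩ := h.isHomKernel_fderiv.exists_bound
  have hs : {q : E × ℝ | p.2 / 2 < q.2} ∈ 𝓝 p :=
    (isOpen_lt continuous_const continuous_snd).mem_nhds (by simp; linarith)
  have hpos : ∀ q ∈ {q : E × ℝ | p.2 / 2 < q.2}, 0 < q.2 := fun q hq => by
    have : p.2 / 2 < q.2 := hq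
    linarith
  refine hasFDerivAt_integral_of_dominated_of_fderiv_le
    (F := fun q y => φ (q.1 - y, q.2) * μ y)
    (F' := fun q y => μ y • fderiv ℝ φ (q.1 - y, q.2))
    (bound := fun y => ‖μ y‖ * (C * (p.2 / 2) ^ (-(β + 1)))) hs ?_ ?_ ?_ ?_ ?_ ?_
  · filter_upwards [hs] with q hq
    exact ((h.continuous_translate (hpos q hq)).mul hμ).aestronglyMeasurable
  · simpa only [smul_eq_mul, mul_comm] using h.integrable_translate hμ hμs hp
  · exact (h.isHomKernel_fderiv.integrable_translate hμ hμs hp).aestronglyMeasurable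
  · refine Eventually.of_forall fun y q hq => ?_
    rw [norm_smul]
    refine mul_le_mul_of_nonneg_left ?_ (norm_nonneg _)
    refine (hbd _ (ne_zero_of_snd_pos (p := (q.1 - y, q.2)) (hpos q hq))).trans ?_
    refine mul_le_mul_of_nonneg_left ?_ hC
    refine rpow_le_rpow_of_nonpos (by linarith) ?_ (by linarith)
    have h1 : p.2 / 2 < q.2 := hq
    have h2 : ‖q.2‖ ≤ ‖(q.1 - y, q.2)‖ := norm_snd_le (q.1 - y, q.2)
    rw [norm_of_nonneg (hpos q hq).le] at h2
    linarith
  · exact ((hμ.integrable_of_hasCompactSupport hμs).norm).mul_const _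
  · refine Eventually.of_forall fun y q hq => ?_
    have h1 : HasFDerivAt (fun q : E × ℝ => (q.1 - y, q.2))
        (ContinuousLinearMap.id ℝ (E × ℝ)) q := by
      have : (fun q : E × ℝ => (q.1 - y, q.2)) = fun q => q - (y, 0) := by
        ext q <;> simp
      rw [this]
      exact (hasFDerivAt_id q).sub_const _
    have h2 := HasFDerivAt.comp q (h.differentiableAt
      (ne_zero_of_snd_pos (p := (q.1 - y, q.2)) (hpos q hq))).hasFDerivAt h1
    simpa using h2.mul_const (μ y)

lemma IsHomKernel.dirDeriv_potential {φ : E × ℝ → ℝ} (h : IsHomKernel β φ) (hβ : 0 ≤ β)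
    (hμ : Continuous μ) (hμs : HasCompactSupport μ) (v : E × ℝ) {p : E × ℝ} (hp : 0 < p.2) :
    dirDeriv v (potential μ φ) p = potential μ (dirDeriv v φ) p := by
  have h1 := h.hasFDerivAt_potential hβ hμ hμs hp
  rw [dirDeriv, h1.fderiv,
    ContinuousLinearMap.integral_apply (h.isHomKernel_fderiv.integrable_translate hμ hμs hp)]
  simp [potential, dirDeriv, mul_comm]

lemma IsHomKernel.dirDeriv_dirDeriv_potential {φ : E × ℝ → ℝ} (h : IsHomKernel β φ) (hβ : 0 ≤ β)
    (hμ : Continuous μ) (hμs : HasCompactSupport μ) (v w : E × ℝ) {p : E × ℝ} (hp : 0 < p.2) :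
    dirDeriv w (dirDeriv v (potential μ φ)) p = potential μ (dirDeriv w (dirDeriv v φ)) p := by
  rw [dirDeriv_congr_of_eqOn isOpen_upperHalf
    (fun q hq => h.dirDeriv_potential hβ hμ hμs v hq) w hp]
  exact (h.isHomKernel_dirDeriv v).dirDeriv_potential (by linarith) hμ hμs w hp

lemma IsHomKernel.continuousOn_potential {φ : E × ℝ → ℝ} (h : IsHomKernel β φ) (hβ : 0 ≤ β)
    (hμ : Continuous μ) (hμs : HasCompactSupport μ) :
    ContinuousOn (potential μ φ) {p | 0 < p.2} := fun _ hp =>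
  (h.hasFDerivAt_potential hβ hμ hμs hp).continuousAt.continuousWithinAt

omit [NormedSpace ℝ E] [FiniteDimensional ℝ E] [BorelSpace E]
  [(volume : Measure E).IsAddHaarMeasure] in
lemma potential_congr {φ ψ : E × ℝ → ℝ} (h : EqOn φ ψ {0}ᶜ) {p : E × ℝ} (hp : 0 < p.2) :
    potential μ φ p = potential μ ψ p := by
  unfold potential
  congr 1 with y
  rw [h (ne_zero_of_snd_pos (p := (p.1 - y, p.2)) hp)]

omit [NormedSpace ℝ E] [FiniteDimensional ℝ E] [BorelSpace E]
  [(volume : Measure E).IsAddHaarMeasure] in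
lemma potential_snd_mul (φ : E × ℝ → ℝ) (p : E × ℝ) :
    potential μ (fun q => q.2 * φ q) p = p.2 * potential μ φ p := by
  simp only [potential, mul_assoc, integral_const_mul]

omit [NormedSpace ℝ E] [FiniteDimensional ℝ E] [BorelSpace E]
  [(volume : Measure E).IsAddHaarMeasure] in
lemma potential_const_mul (c : ℝ) (φ : E × ℝ → ℝ) (p : E × ℝ) :
    potential μ (fun q => c * φ q) p = c * potential μ φ p := by
  simp only [potential, mul_assoc, integral_const_mul]

omit [FiniteDimensional ℝ E] in
lemma IsHomKernel.integrable_mul {φ : E × ℝ → ℝ} (h : IsHomKernel β φ)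
    (hμ : Continuous μ) (hμs : HasCompactSupport μ) {p : E × ℝ} (hp : 0 < p.2) :
    Integrable fun y : E => φ (p.1 - y, p.2) * μ y := by
  simpa only [smul_eq_mul, mul_comm] using h.integrable_translate hμ hμs hp

omit [FiniteDimensional ℝ E] in
lemma IsHomKernel.potential_add {β' : ℝ} {φ ψ : E × ℝ → ℝ} (h : IsHomKernel β φ)
    (h' : IsHomKernel β' ψ) (hμ : Continuous μ) (hμs : HasCompactSupport μ) {p : E × ℝ}
    (hp : 0 < p.2) :
    potential μ (fun q => φ q + ψ q) p = potential μ φ p + potential μ ψ p := by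
  simp only [potential, add_mul]
  exact integral_add (h.integrable_mul hμ hμs hp) (h'.integrable_mul hμ hμs hp)

omit [FiniteDimensional ℝ E] in
lemma IsHomKernel.potential_sum {ι : Type*} (s : Finset ι) {φ : ι → E × ℝ → ℝ}
    (h : ∀ i, IsHomKernel β (φ i)) (hμ : Continuous μ) (hμs : HasCompactSupport μ) {p : E × ℝ}
    (hp : 0 < p.2) :
    potential μ (fun q => ∑ i ∈ s, φ i q) p = ∑ i ∈ s, potential μ (φ i) p := by
  simp only [potential, Finset.sum_mul]
  exact integral_finsetSum s fun i _ => (h i).integrable_mul hμ hμs hp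

end Potentials

section Bounds

variable {E : Type*} [NormedAddCommGroup E] [NormedSpace ℝ E] [FiniteDimensional ℝ E]
  [MeasureSpace E] [BorelSpace E] [(volume : Measure E).IsAddHaarMeasure]
  {μ : E → ℝ} {β : ℝ} {φ : E × ℝ → ℝ}

lemma one_add_norm_le_mul {V : Type*} [SeminormedAddCommGroup V] (p q : V) :
    1 + ‖p‖ ≤ (1 + ‖p - q‖) * (1 + ‖q‖) := by
  have h1 := norm_le_norm_sub_add p q
  nlinarith [norm_nonneg (p - q), norm_nonneg q]

lemma one_add_norm_rpow_neg_le {V : Type*} [SeminormedAddCommGroup V] (hβ : 0 ≤ β) (p q : V) :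
    (1 + ‖p - q‖) ^ (-β) ≤ (1 + ‖p‖) ^ (-β) * (1 + ‖q‖) ^ β := by
  have h1 : (1 + ‖p‖) ^ β ≤ (1 + ‖p - q‖) ^ β * (1 + ‖q‖) ^ β := by
    rw [← mul_rpow (by positivity) (by positivity)]
    exact rpow_le_rpow (by positivity) (one_add_norm_le_mul p q) hβ
  rw [rpow_neg (by positivity), rpow_neg (by positivity)]
  rw [inv_mul_eq_div, inv_eq_one_div, div_le_div_iff₀ (by positivity) (by positivity)]
  linarith

omit [NormedSpace ℝ E] [FiniteDimensional ℝ E] [MeasureSpace E] [BorelSpace E]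
  [(volume : Measure E).IsAddHaarMeasure] in
lemma continuous_weight (hμ : Continuous μ) :
    Continuous fun y : E => (1 + ‖y‖) ^ β * |μ y| := by
  refine Continuous.mul (Continuous.rpow_const (by fun_prop) fun y => Or.inl ?_) hμ.abs
  positivity

omit [NormedSpace ℝ E] [FiniteDimensional ℝ E] [MeasureSpace E] [BorelSpace E]
  [(volume : Measure E).IsAddHaarMeasure] in
lemma hasCompactSupport_weight (hμs : HasCompactSupport μ) :
    HasCompactSupport fun y : E => (1 + ‖y‖) ^ β * |μ y| :=
  HasCompactSupport.mul_left (f := fun y : E => (1 + ‖y‖) ^ β)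
    (f' := fun y => |μ y|) (hμs.comp_left (g := fun t : ℝ => |t|) abs_zero)

lemma IsHomKernel.exists_bound_slice (h : IsHomKernel β φ) (hβ : 0 ≤ β)
    (hμ : Continuous μ) (hμs : HasCompactSupport μ) {ξ : ℝ} (hξ : 0 < ξ) :
    ∃ C, 0 ≤ C ∧ ∀ x, |potential μ φ (x, ξ)| ≤ C * (1 + ‖x‖) ^ (-β) := by
  obtain ⟨C, hC, hbd⟩ := h.exists_bound
  set c : ℝ := min ξ 1 / 2 with hc
  have hc0 : 0 < c := by positivity
  have hw : Integrable fun y : E => (1 + ‖y‖) ^ β * |μ y| :=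
    (continuous_weight hμ).integrable_of_hasCompactSupport (hasCompactSupport_weight hμs)
  refine ⟨C * c ^ (-β) * ∫ y : E, (1 + ‖y‖) ^ β * |μ y|, ?_, fun x => ?_⟩
  · exact mul_nonneg (by positivity) (integral_nonneg fun y => by positivity)
  have hle : ∀ y : E, ‖φ (x - y, ξ) * μ y‖
      ≤ C * c ^ (-β) * (1 + ‖x‖) ^ (-β) * ((1 + ‖y‖) ^ β * |μ y|) := by
    intro y
    have h0 := hbd (x - y, ξ) (ne_zero_of_snd_pos hξ)
    have h1 : c * (1 + ‖x - y‖) ≤ ‖(x - y, ξ)‖ := by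
      have ha : ‖x - y‖ ≤ ‖(x - y, ξ)‖ := norm_fst_le (x - y, ξ)
      have hb : ‖ξ‖ ≤ ‖(x - y, ξ)‖ := norm_snd_le (x - y, ξ)
      rw [norm_of_nonneg hξ.le] at hb
      have hm1 : min ξ 1 ≤ ξ := min_le_left _ _
      have hm2 : min ξ 1 ≤ 1 := min_le_right _ _
      have hn := norm_nonneg (x - y)
      nlinarith
    have h2 : ‖(x - y, ξ)‖ ^ (-β) ≤ c ^ (-β) * (1 + ‖x - y‖) ^ (-β) := by
      rw [← mul_rpow hc0.le (by positivity)]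
      exact rpow_le_rpow_of_nonpos (by positivity) h1 (by linarith)
    have h3 := one_add_norm_rpow_neg_le hβ x y
    rw [norm_mul, norm_eq_abs (μ y)]
    calc ‖φ (x - y, ξ)‖ * |μ y|
        ≤ (C * (c ^ (-β) * ((1 + ‖x‖) ^ (-β) * (1 + ‖y‖) ^ β))) * |μ y| := by
          refine mul_le_mul_of_nonneg_right (h0.trans ?_) (abs_nonneg _)
          refine mul_le_mul_of_nonneg_left (h2.trans ?_) hC
          exact mul_le_mul_of_nonneg_left h3 (by positivity)
      _ = _ := by ring
  have := norm_integral_le_of_norm_le (hw.const_mul _) (Eventually.of_forall hle)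
  rw [integral_const_mul] at this
  unfold potential
  rw [norm_eq_abs] at this
  refine this.trans (le_of_eq ?_)
  ring

lemma integrableOn_norm_rpow_neg_ball [Nontrivial E] (hβ : β < Module.finrank ℝ E) :
    IntegrableOn (fun z : E => ‖z‖ ^ (-β)) (Metric.ball 0 1) := by
  rw [integrableOn_fun_norm_addHaar (volume : Measure E) (f := fun t : ℝ => t ^ (-β))]
  have hn : 0 < Module.finrank ℝ E := Module.finrank_pos
  have h1 : IntegrableOn (fun t : ℝ => t ^ ((Module.finrank ℝ E : ℝ) - 1 - β)) (Ioo 0 1) :=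
    ((intervalIntegral.integrableOn_Ioo_rpow_iff zero_lt_one).2 (by linarith))
  refine h1.congr_fun (fun t ht => ?_) measurableSet_Ioo
  have ht' : 0 < t := ht.1
  simp only [smul_eq_mul]
  rw [← rpow_natCast, ← rpow_add ht', Nat.cast_sub hn, Nat.cast_one, sub_eq_add_neg _ β]

omit [NormedSpace ℝ E] [FiniteDimensional ℝ E] [MeasureSpace E] [BorelSpace E]
  [(volume : Measure E).IsAddHaarMeasure] in
lemma rpow_neg_le_two_rpow_mul (hβ : 0 ≤ β) {z : E} (hz : z ≠ 0) (ξ : ℝ) :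
    ‖(z, ξ)‖ ^ (-β) ≤ 2 ^ β * (1 + ‖(z, ξ)‖) ^ (-β)
      * (1 + (Metric.ball (0 : E) 1).indicator (fun z => ‖z‖ ^ (-β)) z) := by
  have hz' : 0 < ‖z‖ := norm_pos_iff.2 hz
  have hzN : ‖z‖ ≤ ‖(z, ξ)‖ := norm_fst_le (z, ξ)
  set N := ‖(z, ξ)‖
  have hN : 0 < N := hz'.trans_le hzN
  have h2 : (2 : ℝ) ^ β * (1 + N) ^ (-β) = ((1 + N) / 2) ^ (-β) := by
    rw [div_rpow (by positivity) (by positivity), rpow_neg zero_le_two, div_inv_eq_mul, mul_comm]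
  rw [h2]
  have hind : 0 ≤ (Metric.ball (0 : E) 1).indicator (fun z => ‖z‖ ^ (-β)) z :=
    indicator_nonneg (fun z _ => by positivity) z
  rcases le_or_gt 1 N with h | h
  · calc N ^ (-β) ≤ ((1 + N) / 2) ^ (-β) :=
          rpow_le_rpow_of_nonpos (by positivity) (by linarith) (by linarith)
      _ ≤ _ := le_mul_of_one_le_right (by positivity) (by linarith)
  · have hb : z ∈ Metric.ball (0 : E) 1 := by simpa using hzN.trans_lt h
    rw [indicator_of_mem hb]
    have h3 : 1 ≤ ((1 + N) / 2) ^ (-β) :=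
      one_le_rpow_of_pos_of_le_one_of_nonpos (by positivity) (by linarith) (by linarith)
    have h4 : N ^ (-β) ≤ ‖z‖ ^ (-β) := rpow_le_rpow_of_nonpos hz' hzN (by linarith)
    have h5 : 0 ≤ ‖z‖ ^ (-β) := by positivity
    nlinarith

lemma IsHomKernel.exists_bound_uniform [Nontrivial E] (h : IsHomKernel β φ) (hβ : 0 ≤ β)
    (hβ' : β < Module.finrank ℝ E) (hμ : Continuous μ) (hμs : HasCompactSupport μ) :
    ∃ C, 0 ≤ C ∧ ∀ p : E × ℝ, 0 < p.2 → |potential μ φ p| ≤ C * (1 + ‖p‖) ^ (-β) := by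
  obtain ⟨C, hC, hbd⟩ := h.exists_bound
  set w : E → ℝ := fun y => (1 + ‖y‖) ^ β * |μ y| with hwdef
  have hw0 : ∀ y, 0 ≤ w y := fun y => by positivity
  have hwc : Continuous w := continuous_weight hμ
  have hw : Integrable w := hwc.integrable_of_hasCompactSupport (hasCompactSupport_weight hμs)
  obtain ⟨M, hM⟩ := (hasCompactSupport_weight (β := β) hμs).exists_bound_of_continuous hwc
  have hM0 : 0 ≤ M := (norm_nonneg _).trans (hM 0)
  set g : E → ℝ := (Metric.ball (0 : E) 1).indicator (fun z => ‖z‖ ^ (-β)) with hg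
  have hg0 : ∀ z, 0 ≤ g z := fun z => indicator_nonneg (fun z _ => by positivity) z
  have hgi : Integrable g :=
    (integrable_indicator_iff Metric.isOpen_ball.measurableSet).2
      (integrableOn_norm_rpow_neg_ball hβ')
  refine ⟨C * 2 ^ β * ((∫ y, w y) + M * ∫ z, g z), ?_, fun p hp => ?_⟩
  · have h1 : 0 ≤ ∫ y, w y := integral_nonneg hw0
    have h2 : 0 ≤ ∫ y, g y := integral_nonneg hg0
    positivity
  have hle : ∀ᵐ y : E, ‖φ (p.1 - y, p.2) * μ y‖
      ≤ C * 2 ^ β * (1 + ‖p‖) ^ (-β) * (w y + M * g (p.1 - y)) := by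
    filter_upwards [compl_mem_ae_iff.2 (measure_singleton p.1)] with y hy
    have hz : p.1 - y ≠ 0 := sub_ne_zero.2 fun e => hy e.symm
    have h0 := hbd (p.1 - y, p.2) (ne_zero_of_snd_pos hp)
    have h1 := rpow_neg_le_two_rpow_mul hβ hz p.2
    have h2 := one_add_norm_rpow_neg_le hβ p (y, 0)
    have e1 : p - (y, 0) = (p.1 - y, p.2) := by ext <;> simp
    have e2 : ‖((y, 0) : E × ℝ)‖ = ‖y‖ := by simp [Prod.norm_def]
    rw [e1, e2] at h2
    rw [norm_mul, norm_eq_abs (μ y)]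
    have hg1 := hg0 (p.1 - y)
    calc ‖φ (p.1 - y, p.2)‖ * |μ y|
        ≤ (C * (2 ^ β * ((1 + ‖p‖) ^ (-β) * (1 + ‖y‖) ^ β) * (1 + g (p.1 - y)))) * |μ y| := by
          refine mul_le_mul_of_nonneg_right (h0.trans ?_) (abs_nonneg _)
          refine mul_le_mul_of_nonneg_left (h1.trans ?_) hC
          refine mul_le_mul_of_nonneg_right ?_ (by positivity)
          exact mul_le_mul_of_nonneg_left h2 (by positivity)
      _ = C * 2 ^ β * (1 + ‖p‖) ^ (-β) * (w y + w y * g (p.1 - y)) := by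
          simp only [hwdef]
          ring
      _ ≤ _ := by
          refine mul_le_mul_of_nonneg_left ?_ (by positivity)
          have := mul_le_mul_of_nonneg_right ((le_abs_self _).trans (hM y)) hg1
          linarith
  have hgi' : Integrable fun y => g (p.1 - y) := hgi.comp_sub_left p.1
  have := norm_integral_le_of_norm_le ((hw.add (hgi'.const_mul M)).const_mul _) hle
  rw [integral_const_mul] at this
  simp only [Pi.add_apply] at this
  rw [integral_add hw (hgi'.const_mul M), integral_const_mul,
    integral_sub_left_eq_self g volume p.1, norm_eq_abs] at this
  unfold potential
  refine this.trans (le_of_eq ?_)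
  ring

lemma integrableOn_Ioi_rpow_mul_one_add_rpow {γ b : ℝ} (hγ : -1 < γ) (hb : γ + 1 < b) :
    IntegrableOn (fun ξ : ℝ => ξ ^ γ * (1 + ξ) ^ (-b)) (Ioi 0) := by
  have hm : Measurable fun ξ : ℝ => ξ ^ γ * (1 + ξ) ^ (-b) := by fun_prop
  rw [← Ioc_union_Ioi_eq_Ioi zero_le_one]
  refine IntegrableOn.union ?_ ?_
  · have h1 : IntegrableOn (fun t : ℝ => t ^ γ) (Ioc 0 1) :=
      (intervalIntegrable_iff_integrableOn_Ioc_of_le zero_le_one).1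
        (intervalIntegral.intervalIntegrable_rpow' hγ)
    refine Integrable.mono' h1 hm.aestronglyMeasurable ?_
    filter_upwards [ae_restrict_mem measurableSet_Ioc] with ξ hξ
    have h0 : 0 < ξ := hξ.1
    rw [norm_of_nonneg (by positivity)]
    refine mul_le_of_le_one_right (by positivity) ?_
    exact rpow_le_one_of_one_le_of_nonpos (by linarith) (by linarith)
  · have h1 : IntegrableOn (fun t : ℝ => t ^ (γ - b)) (Ioi 1) :=
      integrableOn_Ioi_rpow_of_lt (by linarith) one_pos
    refine Integrable.mono' h1 hm.aestronglyMeasurable ?_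
    filter_upwards [ae_restrict_mem measurableSet_Ioi] with ξ hξ
    have h0 : (1 : ℝ) < ξ := hξ
    rw [norm_of_nonneg (by positivity), sub_eq_add_neg, rpow_add (by linarith)]
    refine mul_le_mul_of_nonneg_left ?_ (by positivity)
    exact rpow_le_rpow_of_nonpos (by linarith) (by linarith) (by linarith)

omit [BorelSpace E] in
lemma volume_restrict_upperHalf :
    (volume : Measure (E × ℝ)).restrict {p | 0 < p.2}
      = (volume : Measure E).prod ((volume : Measure ℝ).restrict (Ioi 0)) := by
  have h1 : {p : E × ℝ | 0 < p.2} = univ ×ˢ Ioi 0 := by ext p; simp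
  rw [h1, Measure.volume_eq_prod, ← Measure.prod_restrict, Measure.restrict_univ]

lemma integrable_snd_rpow_mul_one_add_norm_rpow {γ s : ℝ} (hγ : -1 < γ)
    (hs : Module.finrank ℝ E + γ + 1 < s) :
    IntegrableOn (fun p : E × ℝ => p.2 ^ γ * (1 + ‖p‖) ^ (-s)) {p | 0 < p.2} := by
  set δ := (s - Module.finrank ℝ E - γ - 1) / 2 with hδ
  have hδ0 : 0 < δ := by linarith
  have h1 : Integrable fun x : E => (1 + ‖x‖) ^ (-(Module.finrank ℝ E + δ)) :=
    integrable_one_add_norm (by linarith)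
  have h2 := integrableOn_Ioi_rpow_mul_one_add_rpow hγ (show γ + 1 < γ + 1 + δ by linarith)
  have h3 := h1.mul_prod h2
  rw [← volume_restrict_upperHalf] at h3
  refine Integrable.mono' h3 (Measurable.aestronglyMeasurable (by fun_prop)) ?_
  filter_upwards [ae_restrict_mem isOpen_upperHalf.measurableSet] with p hp
  have hp' : 0 < p.2 := hp
  rw [norm_of_nonneg (by positivity)]
  have ha : ‖p.1‖ ≤ ‖p‖ := norm_fst_le p
  have hb : p.2 ≤ ‖p‖ := by simpa [abs_of_pos hp'] using norm_snd_le p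
  have e : -s = -(Module.finrank ℝ E + δ) + -(γ + 1 + δ) := by rw [hδ]; ring
  rw [e, rpow_add (by positivity)]
  have hn : (0 : ℝ) ≤ Module.finrank ℝ E := by positivity
  have i1 : (1 + ‖p‖) ^ (-(Module.finrank ℝ E + δ)) ≤ (1 + ‖p.1‖) ^ (-(Module.finrank ℝ E + δ)) :=
    rpow_le_rpow_of_nonpos (by positivity) (by linarith) (by linarith)
  have i2 : (1 + ‖p‖) ^ (-(γ + 1 + δ)) ≤ (1 + p.2) ^ (-(γ + 1 + δ)) :=
    rpow_le_rpow_of_nonpos (by positivity) (by linarith) (by linarith)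
  calc p.2 ^ γ * ((1 + ‖p‖) ^ (-(Module.finrank ℝ E + δ)) * (1 + ‖p‖) ^ (-(γ + 1 + δ)))
      ≤ p.2 ^ γ * ((1 + ‖p.1‖) ^ (-(Module.finrank ℝ E + δ)) * (1 + p.2) ^ (-(γ + 1 + δ))) := by
        gcongr
    _ = _ := by ring

end Bounds

section Energy

variable {E : Type*} [NormedAddCommGroup E] [NormedSpace ℝ E] [FiniteDimensional ℝ E]
  [MeasureSpace E] [BorelSpace E] [(volume : Measure E).IsAddHaarMeasure]
  {μ : E → ℝ} {β γ : ℝ} {φ ψ : E × ℝ → ℝ}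

/-- The integral of a directional derivative vanishes, under weak decay of the function. -/
lemma integral_fderiv_apply_eq_zero {f : E → ℝ} {v : E} (hf : Differentiable ℝ f)
    (hf' : Integrable fun x => fderiv ℝ f x v) (hfi : Integrable fun x => f x / (1 + ‖x‖)) :
    ∫ x, fderiv ℝ f x v = 0 := by
  let χ : ContDiffBump (0 : E) := ⟨1, 2, one_pos, one_lt_two⟩
  have hχ : ContDiff ℝ 1 χ := χ.contDiff
  have hχd : Differentiable ℝ χ := hχ.differentiable one_ne_zero
  have hχ' : Continuous fun x => fderiv ℝ χ x v :=
    (hχ.continuous_fderiv one_ne_zero).clm_apply continuous_const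
  obtain ⟨M, hM⟩ : ∃ M, ∀ y, ‖(1 + ‖y‖) * fderiv ℝ χ y v‖ ≤ M := by
    refine Continuous.bounded_above_of_compact_support (by fun_prop) ?_
    exact (χ.hasCompactSupport.fderiv_apply ℝ v).mul_left
  let ε : ℕ → ℝ := fun n => 1 / ((n : ℝ) + 1)
  have hε0 : ∀ n, 0 < ε n := fun n => by positivity
  have hε1 : ∀ n, ε n ≤ 1 := fun n => by
    rw [div_le_one (by positivity)]
    simp
  have hεt : Tendsto ε atTop (𝓝 0) := tendsto_one_div_add_atTop_nhds_zero_nat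
  have hεx : ∀ x : E, Tendsto (fun n => ε n • x) atTop (𝓝 0) := fun x => by
    simpa using hεt.smul_const x
  have hcd : ∀ n x, HasFDerivAt (fun x => χ (ε n • x))
      ((fderiv ℝ χ (ε n • x)).comp (ε n • ContinuousLinearMap.id ℝ E)) x := fun n x =>
    (hχd (ε n • x)).hasFDerivAt.comp x ((hasFDerivAt_id x).const_smul (ε n))
  have hcd' : ∀ n x, fderiv ℝ (fun x => χ (ε n • x)) x v
      = ε n * fderiv ℝ χ (ε n • x) v := fun n x => by
    rw [(hcd n x).fderiv]
    simp
  have hcs : ∀ n, HasCompactSupport fun x => χ (ε n • x) := fun n =>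
    χ.hasCompactSupport.comp_smul (hε0 n).ne'
  have hdom : ∀ n x, ‖f x * (ε n * fderiv ℝ χ (ε n • x) v)‖ ≤ M * ‖f x / (1 + ‖x‖)‖ :=
    fun n x => by
    have h1 := hM (ε n • x)
    rw [norm_mul, norm_smul, norm_of_nonneg (hε0 n).le,
      norm_of_nonneg (by have := (hε0 n).le; positivity : 0 ≤ 1 + ε n * ‖x‖)] at h1
    rw [norm_mul, norm_mul, norm_of_nonneg (hε0 n).le, norm_div,
      norm_of_nonneg (by positivity : 0 ≤ 1 + ‖x‖), mul_div_assoc', le_div_iff₀ (by positivity)]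
    have h2 : ε n * (1 + ‖x‖) ≤ 1 + ε n * ‖x‖ := by linarith [hε1 n]
    calc ‖f x‖ * (ε n * ‖fderiv ℝ χ (ε n • x) v‖) * (1 + ‖x‖)
        = ‖f x‖ * ((ε n * (1 + ‖x‖)) * ‖fderiv ℝ χ (ε n • x) v‖) := by ring
      _ ≤ ‖f x‖ * M := by
        gcongr
        exact (mul_le_mul_of_nonneg_right h2 (norm_nonneg _)).trans h1
      _ = M * ‖f x‖ := mul_comm _ _
  have hm : ∀ n, AEStronglyMeasurable (fun x => f x * (ε n * fderiv ℝ χ (ε n • x) v)) volume :=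
    fun n => (hf.continuous.mul (continuous_const.mul
      (hχ'.comp (continuous_const_smul (ε n))))).aestronglyMeasurable
  have hbd : ∀ n x, ‖fderiv ℝ f x v * χ (ε n • x)‖ ≤ ‖fderiv ℝ f x v‖ := fun n x => by
    rw [norm_mul, norm_of_nonneg χ.nonneg]
    exact mul_le_of_le_one_right (norm_nonneg _) χ.le_one
  have hm' : ∀ n, AEStronglyMeasurable (fun x => fderiv ℝ f x v * χ (ε n • x)) volume := fun n =>
    hf'.aestronglyMeasurable.mul
      (χ.continuous.comp (continuous_const_smul (ε n))).aestronglyMeasurable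
  have hibp : ∀ n, ∫ x, f x * (ε n * fderiv ℝ χ (ε n • x) v)
      = -∫ x, fderiv ℝ f x v * χ (ε n • x) := fun n => by
    have key := integral_mul_fderiv_eq_neg_fderiv_mul_of_integrable (𝕜 := ℝ) (μ := volume)
      (f := f) (g := fun x => χ (ε n • x)) (v := v)
      (hf'.mono (hm' n) (Eventually.of_forall (hbd n)))
      ?_ ?_ (fun x _ => hf x) (fun x _ => (hcd n x).differentiableAt)
    · simpa only [hcd'] using key
    · simp only [hcd']
      exact (hfi.norm.const_mul M).mono' (hm n) (Eventually.of_forall (hdom n))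
    · exact (hf.continuous.mul (χ.continuous.comp
        (continuous_const_smul (ε n)))).integrable_of_hasCompactSupport (hcs n).mul_left
  have l1 : Tendsto (fun n => ∫ x, f x * (ε n * fderiv ℝ χ (ε n • x) v)) atTop
      (𝓝 (∫ _ : E, (0 : ℝ))) := by
    refine tendsto_integral_of_dominated_convergence _ hm (hfi.norm.const_mul M)
      (fun n => Eventually.of_forall (hdom n)) (Eventually.of_forall fun x => ?_)
    have := (hεt.mul ((hχ'.tendsto 0).comp (hεx x))).const_mul (f x)
    simpa using this
  have l2 : Tendsto (fun n => ∫ x, fderiv ℝ f x v * χ (ε n • x)) atTop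
      (𝓝 (∫ x, fderiv ℝ f x v)) := by
    refine tendsto_integral_of_dominated_convergence _ hm' hf'.norm
      (fun n => Eventually.of_forall (hbd n)) (Eventually.of_forall fun x => ?_)
    have h1 : χ (0 : E) = 1 := χ.one_of_mem_closedBall (by simp [χ])
    have := ((χ.continuous.tendsto 0).comp (hεx x)).const_mul (fderiv ℝ f x v)
    rwa [h1, mul_one] at this
  simp only [hibp, integral_zero] at l1
  simpa using tendsto_nhds_unique l1 l2.neg

/-- The weighted `L²` pairing of the potentials of `μ` with kernels `φ` and `ψ` over the upper
half-space. -/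
def energy (γ : ℝ) (μ : E → ℝ) (φ ψ : E × ℝ → ℝ) : ℝ :=
  ∫ p in {p : E × ℝ | 0 < p.2}, p.2 ^ γ * (potential μ φ p * potential μ ψ p)

omit [NormedSpace ℝ E] [FiniteDimensional ℝ E] [BorelSpace E]
  [(volume : Measure E).IsAddHaarMeasure] in
lemma energy_comm : energy γ μ φ ψ = energy γ μ ψ φ := by
  simp only [energy, mul_comm (potential μ φ _)]

omit [NormedSpace ℝ E] [FiniteDimensional ℝ E] [(volume : Measure E).IsAddHaarMeasure] in
lemma energy_congr {φ' ψ' : E × ℝ → ℝ} (h : EqOn φ φ' {0}ᶜ) (h' : EqOn ψ ψ' {0}ᶜ) :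
    energy γ μ φ ψ = energy γ μ φ' ψ' := by
  refine setIntegral_congr_fun isOpen_upperHalf.measurableSet fun p hp => ?_
  simp only [potential_congr h hp, potential_congr h' hp]

omit [NormedSpace ℝ E] [FiniteDimensional ℝ E] [BorelSpace E]
  [(volume : Measure E).IsAddHaarMeasure] in
lemma energy_const_mul_left (c : ℝ) :
    energy γ μ (fun p => c * φ p) ψ = c * energy γ μ φ ψ := by
  simp only [energy, potential_const_mul, ← integral_const_mul]
  congr 1 with p
  ring

omit [NormedSpace ℝ E] [FiniteDimensional ℝ E] [BorelSpace E]
  [(volume : Measure E).IsAddHaarMeasure] in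
lemma energy_const_mul_right (c : ℝ) :
    energy γ μ φ (fun p => c * ψ p) = c * energy γ μ φ ψ := by
  rw [energy_comm, energy_const_mul_left, energy_comm]

/-- `β` and `γ` are such that products of two potentials with kernels of degree `-β` are
integrable over the upper half-space against `ξ ^ γ`. -/
structure AdmissibleExponents (n : ℕ) (β γ : ℝ) : Prop where
  neg_one_lt : -1 < γ
  nonneg : 0 ≤ β
  lt_dim : β < n
  dim_lt : n + γ + 1 < 2 * β

variable [Nontrivial E] (hA : AdmissibleExponents (Module.finrank ℝ E) β γ)
  (hμ : Continuous μ) (hμs : HasCompactSupport μ)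

include hA hμ hμs

lemma IsHomKernel.integrableOn_energy (h : IsHomKernel β φ) (h' : IsHomKernel β ψ) :
    IntegrableOn (fun p : E × ℝ => p.2 ^ γ * (potential μ φ p * potential μ ψ p))
      {p | 0 < p.2} := by
  obtain ⟨C, hC, hb⟩ := h.exists_bound_uniform hA.nonneg hA.lt_dim hμ hμs
  obtain ⟨C', hC', hb'⟩ := h'.exists_bound_uniform hA.nonneg hA.lt_dim hμ hμs
  have hi := integrable_snd_rpow_mul_one_add_norm_rpow (E := E) hA.neg_one_lt hA.dim_lt
  have hm : ContinuousOn (fun p : E × ℝ => p.2 ^ γ * (potential μ φ p * potential μ ψ p))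
      {p | 0 < p.2} := by
    refine ContinuousOn.mul ?_ ((h.continuousOn_potential hA.nonneg hμ hμs).mul
      (h'.continuousOn_potential hA.nonneg hμ hμs))
    exact continuousOn_snd.rpow_const fun p hp => Or.inl (ne_of_gt hp)
  refine Integrable.mono' (hi.const_mul (C * C'))
    (hm.aestronglyMeasurable isOpen_upperHalf.measurableSet) ?_
  filter_upwards [ae_restrict_mem isOpen_upperHalf.measurableSet] with p hp
  have hp' : 0 < p.2 := hp
  rw [norm_mul, norm_mul, norm_of_nonneg (by positivity : 0 ≤ p.2 ^ γ), norm_eq_abs, norm_eq_abs]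
  have e : -(2 * β) = -β + -β := by ring
  rw [e, rpow_add (by positivity)]
  calc p.2 ^ γ * (|potential μ φ p| * |potential μ ψ p|)
      ≤ p.2 ^ γ * ((C * (1 + ‖p‖) ^ (-β)) * (C' * (1 + ‖p‖) ^ (-β))) := by
        gcongr
        exacts [hb p hp, hb' p hp]
    _ = _ := by ring

lemma energy_add_left {φ' : E × ℝ → ℝ} (h : IsHomKernel β φ) (h' : IsHomKernel β φ')
    (hψ : IsHomKernel β ψ) :
    energy γ μ (fun p => φ p + φ' p) ψ = energy γ μ φ ψ + energy γ μ φ' ψ := by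
  unfold energy
  rw [← integral_add (h.integrableOn_energy hA hμ hμs hψ) (h'.integrableOn_energy hA hμ hμs hψ)]
  refine setIntegral_congr_fun isOpen_upperHalf.measurableSet fun p hp => ?_
  simp only [h.potential_add h' hμ hμs hp]
  ring

lemma energy_add_right {ψ' : E × ℝ → ℝ} (h : IsHomKernel β φ) (hψ : IsHomKernel β ψ)
    (hψ' : IsHomKernel β ψ') :
    energy γ μ φ (fun p => ψ p + ψ' p) = energy γ μ φ ψ + energy γ μ φ ψ' := by
  rw [energy_comm, energy_add_left hA hμ hμs hψ hψ' h, energy_comm, energy_comm (φ := ψ')]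

lemma energy_sum_left {ι : Type*} (s : Finset ι) {φ : ι → E × ℝ → ℝ}
    (h : ∀ i, IsHomKernel β (φ i)) (hψ : IsHomKernel β ψ) :
    energy γ μ (fun p => ∑ i ∈ s, φ i p) ψ = ∑ i ∈ s, energy γ μ (φ i) ψ := by
  unfold energy
  rw [← integral_finsetSum s fun i _ => (h i).integrableOn_energy hA hμ hμs hψ]
  refine setIntegral_congr_fun isOpen_upperHalf.measurableSet fun p hp => ?_
  simp only [IsHomKernel.potential_sum s h hμ hμs hp, Finset.sum_mul, Finset.mul_sum]

lemma energy_sum_right {ι : Type*} (s : Finset ι) {ψ : ι → E × ℝ → ℝ}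
    (h : IsHomKernel β φ) (hψ : ∀ i, IsHomKernel β (ψ i)) :
    energy γ μ φ (fun p => ∑ i ∈ s, ψ i p) = ∑ i ∈ s, energy γ μ φ (ψ i) := by
  simp only [energy_comm (φ := φ)]
  exact energy_sum_left hA hμ hμs s hψ h

lemma energy_eq_integral_slices (h : IsHomKernel β φ) (h' : IsHomKernel β ψ) :
    energy γ μ φ ψ = ∫ ξ in Ioi (0 : ℝ),
      ξ ^ γ * ∫ x : E, potential μ φ (x, ξ) * potential μ ψ (x, ξ) := by
  have hi := h.integrableOn_energy hA hμ hμs h'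
  unfold energy
  rw [IntegrableOn, volume_restrict_upperHalf] at hi
  rw [volume_restrict_upperHalf, integral_prod_symm _ hi]
  simp only [integral_const_mul]

omit [Nontrivial E] hA

lemma exists_bound_potential_mul_potential_slice {a b : ℝ} (h : IsHomKernel a φ)
    (h' : IsHomKernel b ψ) (ha : 0 ≤ a) (hb : 0 ≤ b) {ξ : ℝ} (hξ : 0 < ξ) :
    ∃ C, ∀ x : E, ‖potential μ φ (x, ξ) * potential μ ψ (x, ξ)‖
      ≤ C * (1 + ‖x‖) ^ (-(a + b)) := by
  obtain ⟨C, hC, hbd⟩ := h.exists_bound_slice ha hμ hμs hξ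
  obtain ⟨C', hC', hbd'⟩ := h'.exists_bound_slice hb hμ hμs hξ
  refine ⟨C * C', fun x => ?_⟩
  rw [norm_mul, norm_eq_abs, norm_eq_abs, neg_add, rpow_add (by positivity)]
  calc |potential μ φ (x, ξ)| * |potential μ ψ (x, ξ)|
      ≤ (C * (1 + ‖x‖) ^ (-a)) * (C' * (1 + ‖x‖) ^ (-b)) := by
        gcongr
        exacts [hbd x, hbd' x]
    _ = _ := by ring

lemma IsHomKernel.continuous_potential_slice {c : ℝ} (h : IsHomKernel c φ) (hc : 0 ≤ c) {ξ : ℝ}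
    (hξ : 0 < ξ) : Continuous fun x : E => potential μ φ (x, ξ) :=
  (h.continuousOn_potential hc hμ hμs).comp_continuous (by fun_prop) fun _ => hξ

lemma integrable_potential_mul_potential_slice {a b : ℝ} (h : IsHomKernel a φ)
    (h' : IsHomKernel b ψ) (ha : 0 ≤ a) (hb : 0 ≤ b) (hab : Module.finrank ℝ E < a + b)
    {ξ : ℝ} (hξ : 0 < ξ) :
    Integrable fun x : E => potential μ φ (x, ξ) * potential μ ψ (x, ξ) := by
  obtain ⟨C, hC⟩ := exists_bound_potential_mul_potential_slice hμ hμs h h' ha hb hξ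
  exact Integrable.mono' ((integrable_one_add_norm hab).const_mul C)
    ((h.continuous_potential_slice hμ hμs ha hξ).mul
      (h'.continuous_potential_slice hμ hμs hb hξ)).aestronglyMeasurable
    (Eventually.of_forall hC)

/-- Integration by parts in a horizontal direction, on a horizontal slice. -/
lemma integral_potential_mul_dirDeriv_slice {a b : ℝ} (h : IsHomKernel a φ)
    (h' : IsHomKernel b ψ) (ha : 0 ≤ a) (hb : 0 ≤ b) (hab : Module.finrank ℝ E < a + b + 1)
    {ξ : ℝ} (hξ : 0 < ξ) (v : E) :
    ∫ x : E, potential μ φ (x, ξ) * potential μ (dirDeriv (v, 0) ψ) (x, ξ)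
      = -∫ x : E, potential μ (dirDeriv (v, 0) φ) (x, ξ) * potential μ ψ (x, ξ) := by
  have hd : ∀ {c : ℝ} {χ : E × ℝ → ℝ}, IsHomKernel c χ → 0 ≤ c → ∀ x : E,
      HasFDerivAt (fun x : E => potential μ χ (x, ξ))
        ((fderiv ℝ (potential μ χ) (x, ξ)).comp (ContinuousLinearMap.inl ℝ E ℝ)) x :=
    fun hχ hc x => by
      have h1 := (hχ.hasFDerivAt_potential hc hμ hμs
        (p := (x, ξ)) hξ).differentiableAt.hasFDerivAt
      have h2 : HasFDerivAt (fun e : E => (e, ξ)) (ContinuousLinearMap.inl ℝ E ℝ) x :=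
        hasFDerivAt_prodMk_left x ξ
      exact h1.comp x h2
  have i1 := integrable_potential_mul_potential_slice hμ hμs h (h'.isHomKernel_dirDeriv (v, 0))
      ha (by linarith) (by linarith) hξ
  have i2 := integrable_potential_mul_potential_slice hμ hμs (h.isHomKernel_dirDeriv (v, 0)) h'
      (by linarith) hb (by linarith) hξ
  have e : ∀ x : E, fderiv ℝ (fun x : E => potential μ φ (x, ξ) * potential μ ψ (x, ξ)) x v
      = potential μ φ (x, ξ) * potential μ (dirDeriv (v, 0) ψ) (x, ξ)
        + potential μ (dirDeriv (v, 0) φ) (x, ξ) * potential μ ψ (x, ξ) := fun x => by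
    rw [((hd h ha x).fun_mul (hd h' hb x)).fderiv, ← h.dirDeriv_potential ha hμ hμs (v, 0) hξ,
      ← h'.dirDeriv_potential hb hμ hμs (v, 0) hξ]
    simp [dirDeriv, mul_comm]
  obtain ⟨C, hC⟩ := exists_bound_potential_mul_potential_slice hμ hμs h h' ha hb hξ
  have key := integral_fderiv_apply_eq_zero
    (f := fun x : E => potential μ φ (x, ξ) * potential μ ψ (x, ξ)) (v := v)
    (fun x => ((hd h ha x).fun_mul (hd h' hb x)).differentiableAt) ?_ ?_
  · simp only [e] at key
    rw [integral_add i1 i2] at key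
    linarith
  · simp only [e]
    exact i1.add i2
  · refine Integrable.mono' ((integrable_one_add_norm hab).const_mul C)
      (((h.continuous_potential_slice hμ hμs ha hξ).mul
      (h'.continuous_potential_slice hμ hμs hb hξ)).div₀ (by fun_prop)
        fun x => by positivity).aestronglyMeasurable (Eventually.of_forall fun x => ?_)
    rw [norm_div, norm_of_nonneg (by positivity : 0 ≤ 1 + ‖x‖), neg_add _ (1 : ℝ),
      rpow_add (by positivity), rpow_neg_one, ← mul_assoc, ← div_eq_mul_inv]
    gcongr
    exact hC x

variable [Nontrivial E]
include hA

lemma energy_dirDeriv_dirDeriv_swap (h : IsHomKernel (β - 2) φ) (hβ : 2 ≤ β)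
    (v w : E) :
    energy γ μ (dirDeriv (v, 0) (dirDeriv (w, 0) φ)) (dirDeriv (v, 0) (dirDeriv (w, 0) φ))
      = energy γ μ (dirDeriv (v, 0) (dirDeriv (v, 0) φ))
          (dirDeriv (w, 0) (dirDeriv (w, 0) φ)) := by
  have h1 : ∀ u : E, IsHomKernel (β - 1) (dirDeriv (u, 0) φ) := fun u =>
    (h.isHomKernel_dirDeriv _).of_eq (by ring)
  have h2 : ∀ u u' : E, IsHomKernel β (dirDeriv (u', 0) (dirDeriv (u, 0) φ)) := fun u u' =>
    ((h1 u).isHomKernel_dirDeriv _).of_eq (by ring)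
  rw [energy_eq_integral_slices hA hμ hμs (h2 w v) (h2 w v),
    energy_eq_integral_slices hA hμ hμs (h2 v v) (h2 w w)]
  refine setIntegral_congr_fun measurableSet_Ioi fun ξ hξ => ?_
  have hξ' : 0 < ξ := hξ
  have hn := hA.dim_lt
  have hg := hA.neg_one_lt
  have i1 := integral_potential_mul_dirDeriv_slice hμ hμs (h2 w v) (h1 w) (by linarith)
    (by linarith) (by linarith) hξ' v
  have i2 := integral_potential_mul_dirDeriv_slice hμ hμs (h2 v v) (h1 w) (by linarith)
    (by linarith) (by linarith) hξ' w
  have e : EqOn (dirDeriv (v, 0) (dirDeriv (v, 0) (dirDeriv (w, 0) φ)))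
      (dirDeriv (w, 0) (dirDeriv (v, 0) (dirDeriv (v, 0) φ))) {0}ᶜ := fun p hp => by
    rw [← (h1 v).dirDeriv_comm (v, 0) (w, 0) hp]
    exact dirDeriv_congr_of_eqOn isOpen_compl_singleton
      (fun q hq => h.dirDeriv_comm (v, 0) (w, 0) hq) _ hp
  have e' : ∀ x : E, potential μ (dirDeriv (v, 0) (dirDeriv (v, 0) (dirDeriv (w, 0) φ))) (x, ξ)
      = potential μ (dirDeriv (w, 0) (dirDeriv (v, 0) (dirDeriv (v, 0) φ))) (x, ξ) :=
    fun x => potential_congr e hξ'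
  simp only [e'] at i1
  simp only [i1, i2]

lemma energy_snd_mul_dirDeriv (h : IsHomKernel β φ) (v : E) :
    energy γ μ (fun p => p.2 * dirDeriv (v, 0) φ p) (fun p => p.2 * dirDeriv (v, 0) φ p)
      = -energy γ μ φ (fun p => p.2 * (p.2 * dirDeriv (v, 0) (dirDeriv (v, 0) φ) p)) := by
  have h1 : IsHomKernel (β + 1) (dirDeriv (v, 0) φ) := h.isHomKernel_dirDeriv _
  have h2 : IsHomKernel β (fun p : E × ℝ => p.2 * dirDeriv (v, 0) φ p) :=
    h1.snd_mul.of_eq (by ring)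
  have h3 : IsHomKernel β
      (fun p : E × ℝ => p.2 * (p.2 * dirDeriv (v, 0) (dirDeriv (v, 0) φ) p)) :=
    (h1.isHomKernel_dirDeriv _).snd_mul.snd_mul.of_eq (by ring)
  rw [energy_eq_integral_slices hA hμ hμs h2 h2, energy_eq_integral_slices hA hμ hμs h h3,
    ← integral_neg]
  refine setIntegral_congr_fun measurableSet_Ioi fun ξ hξ => ?_
  have hξ' : 0 < ξ := hξ
  have hn := hA.dim_lt
  have hg := hA.neg_one_lt
  have hβ := hA.nonneg
  have i1 := integral_potential_mul_dirDeriv_slice hμ hμs h h1 hβ (by linarith)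
    (by linarith) hξ' v
  simp only [potential_snd_mul]
  have e1 : ∀ x : E, ξ * potential μ (dirDeriv (v, 0) φ) (x, ξ)
      * (ξ * potential μ (dirDeriv (v, 0) φ) (x, ξ)) = ξ ^ 2 *
      (potential μ (dirDeriv (v, 0) φ) (x, ξ) * potential μ (dirDeriv (v, 0) φ) (x, ξ)) :=
    fun x => by ring
  have e2 : ∀ x : E, potential μ φ (x, ξ)
      * (ξ * (ξ * potential μ (dirDeriv (v, 0) (dirDeriv (v, 0) φ)) (x, ξ))) = ξ ^ 2 *
      (potential μ φ (x, ξ) * potential μ (dirDeriv (v, 0) (dirDeriv (v, 0) φ)) (x, ξ)) :=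
    fun x => by ring
  simp only [e1, e2, integral_const_mul, i1]
  ring

omit [Nontrivial E] in
lemma hasDerivAt_rpow_mul_potential_mul_potential (h : IsHomKernel β φ) (h' : IsHomKernel β ψ)
    (x : E) {ξ : ℝ} (hξ : 0 < ξ) :
    HasDerivAt (fun t : ℝ => t ^ (γ + 1) * (potential μ φ (x, t) * potential μ ψ (x, t)))
      ((γ + 1) * (ξ ^ γ * (potential μ φ (x, ξ) * potential μ ψ (x, ξ)))
        + (ξ ^ γ * (potential μ (fun p => p.2 * dirDeriv (0, 1) φ p) (x, ξ)
            * potential μ ψ (x, ξ))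
          + ξ ^ γ * (potential μ φ (x, ξ)
            * potential μ (fun p => p.2 * dirDeriv (0, 1) ψ p) (x, ξ)))) ξ := by
  have hd : ∀ {χ : E × ℝ → ℝ}, IsHomKernel β χ → HasDerivAt (fun t : ℝ => potential μ χ (x, t))
      (potential μ (dirDeriv (0, 1) χ) (x, ξ)) ξ := fun {χ} hχ => by
    have h1 := (hχ.hasFDerivAt_potential hA.nonneg hμ hμs
      (p := (x, ξ)) hξ).differentiableAt.hasFDerivAt
    have h2 : HasDerivAt (fun t : ℝ => (x, t)) ((0 : E), (1 : ℝ)) ξ :=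
      (hasDerivAt_const ξ x).prodMk (hasDerivAt_id ξ)
    have h3 := h1.comp_hasDerivAt ξ h2
    rw [← hχ.dirDeriv_potential hA.nonneg hμ hμs (0, 1) hξ]
    exact h3
  have hr : HasDerivAt (fun t : ℝ => t ^ (γ + 1)) ((γ + 1) * ξ ^ γ) ξ := by
    simpa using hasDerivAt_rpow_const (p := γ + 1) (Or.inl hξ.ne')
  refine (hr.fun_mul ((hd h).fun_mul (hd h'))).congr_deriv ?_
  simp only [potential_snd_mul]
  rw [rpow_add hξ, rpow_one]
  ring

/-- Integration by parts in the vertical direction. -/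
lemma energy_scaling (h : IsHomKernel β φ) (h' : IsHomKernel β ψ) :
    (γ + 1) * energy γ μ φ ψ + (energy γ μ (fun p => p.2 * dirDeriv (0, 1) φ p) ψ
      + energy γ μ φ (fun p => p.2 * dirDeriv (0, 1) ψ p)) = 0 := by
  have k1 : ∀ {χ : E × ℝ → ℝ}, IsHomKernel β χ →
      IsHomKernel β (fun p : E × ℝ => p.2 * dirDeriv (0, 1) χ p) := fun hχ =>
    (hχ.isHomKernel_dirDeriv _).snd_mul.of_eq (by ring)
  have i1 := (h.integrableOn_energy hA hμ hμs h').const_mul (γ + 1)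
  have i2 := (k1 h).integrableOn_energy hA hμ hμs h'
  have i3 := h.integrableOn_energy hA hμ hμs (k1 h')
  have i23 := i2.add i3
  have itot := i1.add i23
  unfold energy
  rw [← integral_const_mul, ← integral_add' i2 i3, ← integral_add' i1 i23]
  rw [volume_restrict_upperHalf] at itot
  rw [volume_restrict_upperHalf]
  refine (integral_prod _ itot).trans ?_
  refine integral_eq_zero_of_ae ?_
  obtain ⟨C, hC, hb⟩ := h.exists_bound_uniform hA.nonneg hA.lt_dim hμ hμs
  obtain ⟨C', hC', hb'⟩ := h'.exists_bound_uniform hA.nonneg hA.lt_dim hμ hμs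
  have hn := hA.dim_lt
  have hg := hA.neg_one_lt
  have hβ := hA.nonneg
  filter_upwards [itot.prod_right_ae] with x hx
  have hbound : ∀ t : ℝ, 0 < t →
      ‖t ^ (γ + 1) * (potential μ φ (x, t) * potential μ ψ (x, t))‖
        ≤ C * C' * (t ^ (γ + 1) * (1 + t) ^ (-(2 * β))) := fun t ht => by
    have ha : t ≤ ‖(x, t)‖ := (le_abs_self t).trans (norm_snd_le (x, t))
    have hle : (1 + ‖(x, t)‖) ^ (-β) ≤ (1 + t) ^ (-β) :=
      rpow_le_rpow_of_nonpos (by positivity) (by linarith) (by linarith)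
    have e : (1 + t) ^ (-(2 * β)) = (1 + t) ^ (-β) * (1 + t) ^ (-β) := by
      rw [← rpow_add (by positivity)]
      ring_nf
    rw [norm_mul, norm_mul, norm_of_nonneg (by positivity : 0 ≤ t ^ (γ + 1)), norm_eq_abs,
      norm_eq_abs, e]
    calc t ^ (γ + 1) * (|potential μ φ (x, t)| * |potential μ ψ (x, t)|)
        ≤ t ^ (γ + 1) * ((C * (1 + t) ^ (-β)) * (C' * (1 + t) ^ (-β))) := by
          gcongr
          · exact (hb (x, t) ht).trans (mul_le_mul_of_nonneg_left hle hC)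
          · exact (hb' (x, t) ht).trans (mul_le_mul_of_nonneg_left hle hC')
      _ = _ := by ring
  have h0 : (0 : ℝ) ^ (γ + 1) = 0 := zero_rpow (by linarith)
  have hftc := integral_Ioi_of_hasDerivAt_of_tendsto (a := 0) (m := 0)
    (f := fun t : ℝ => t ^ (γ + 1) * (potential μ φ (x, t) * potential μ ψ (x, t))) ?_
    (fun ξ hξ => hasDerivAt_rpow_mul_potential_mul_potential hA hμ hμs h h' x hξ) hx ?_
  · simp only [h0, zero_mul, sub_zero] at hftc
    exact hftc
  · have hz : Tendsto (fun t : ℝ => C * C' * t ^ (γ + 1)) (𝓝[≥] 0) (𝓝 0) := by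
      have hc : Continuous fun t : ℝ => C * C' * t ^ (γ + 1) :=
        continuous_const.mul (continuous_id.rpow_const fun _ => Or.inr (by linarith))
      have := hc.tendsto 0
      simp only [h0, mul_zero] at this
      exact this.mono_left nhdsWithin_le_nhds
    unfold ContinuousWithinAt
    simp only [h0, zero_mul]
    refine squeeze_zero_norm' ?_ hz
    filter_upwards [self_mem_nhdsWithin] with t ht
    rcases (show (0 : ℝ) ≤ t from ht).eq_or_lt with rfl | ht'
    · simp [h0]
    · refine (hbound t ht').trans ?_
      gcongr
      refine mul_le_of_le_one_right (by positivity) ?_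
      exact rpow_le_one_of_one_le_of_nonpos (by linarith) (by linarith)
  · have hz : Tendsto (fun t : ℝ => C * C' * t ^ (-(2 * β - (γ + 1)))) atTop (𝓝 0) := by
      have hn0 : (0 : ℝ) ≤ Module.finrank ℝ E := by positivity
      have := (tendsto_rpow_neg_atTop (y := 2 * β - (γ + 1)) (by linarith)).const_mul (C * C')
      simpa using this
    refine squeeze_zero_norm' ?_ hz
    filter_upwards [eventually_gt_atTop (0 : ℝ)] with t ht
    refine (hbound t ht).trans ?_
    have e : t ^ (-(2 * β - (γ + 1))) = t ^ (γ + 1) * t ^ (-(2 * β)) := by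
      rw [← rpow_add ht]
      ring_nf
    rw [e]
    have hle : (1 + t) ^ (-(2 * β)) ≤ t ^ (-(2 * β)) :=
      rpow_le_rpow_of_nonpos ht (by linarith) (by linarith)
    gcongr

end Energy

section Coordinates

variable {d : ℕ} {α γ : ℝ} {μ : EuclideanSpace ℝ (Fin d) → ℝ}

/-- The horizontal coordinate direction `i`. -/
def horizontal (i : Fin d) : EuclideanSpace ℝ (Fin d) := EuclideanSpace.single i 1

lemma dir_castSucc (i : Fin d) : dir d i.castSucc = (horizontal i, 0) := by
  simp [dir, horizontal]

lemma dir_last : dir d (Fin.last d) = (0, 1) := by simp [dir]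

lemma prodInner_horizontal (p : EuclideanSpace ℝ (Fin d) × ℝ) (i : Fin d) :
    prodInner p (horizontal i, 0) = p.1 i := by
  simp [prodInner, horizontal, EuclideanSpace.inner_single_right]

lemma prodInner_vertical (p : EuclideanSpace ℝ (Fin d) × ℝ) : prodInner p (0, 1) = p.2 := by
  simp [prodInner]

lemma sum_coord_sq (x : EuclideanSpace ℝ (Fin d)) : ∑ i, x i * x i = ‖x‖ ^ 2 := by
  rw [EuclideanSpace.norm_sq_eq]
  simp [sq]

variable {p : EuclideanSpace ℝ (Fin d) × ℝ}

lemma dirDeriv_vertical_rieszKernel (β : ℝ) (hp : p ≠ 0) :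
    dirDeriv (0, 1) (rieszKernel β) p = -β * (p.2 * rieszKernel (β + 2) p) := by
  rw [dirDeriv_rieszKernel β _ hp, prodInner_vertical]

lemma dirDeriv_vertical_vertical_rieszKernel (β : ℝ) (hp : p ≠ 0) :
    dirDeriv (0, 1) (dirDeriv (0, 1) (rieszKernel β)) p
      = -β * (rieszKernel (β + 2) p + p.2 * dirDeriv (0, 1) (rieszKernel (β + 2)) p) := by
  rw [dirDeriv_dirDeriv_rieszKernel β _ _ hp, dirDeriv_vertical_rieszKernel _ hp]
  simp only [prodInner_vertical]
  rw [show β + 2 + 2 = β + 4 by ring]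
  ring

lemma dirDeriv_horizontal_vertical_rieszKernel (β : ℝ) (i : Fin d) (hp : p ≠ 0) :
    dirDeriv (horizontal i, 0) (dirDeriv (0, 1) (rieszKernel β)) p
      = -β * (p.2 * dirDeriv (horizontal i, 0) (rieszKernel (β + 2)) p) := by
  rw [dirDeriv_dirDeriv_rieszKernel β _ _ hp, dirDeriv_rieszKernel _ _ hp]
  simp only [prodInner_vertical, prodInner_horizontal]
  rw [show β + 2 + 2 = β + 4 by ring]
  ring

lemma sum_dirDeriv_horizontal_rieszKernel (β : ℝ) (hp : p ≠ 0) :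
    ∑ i : Fin d, dirDeriv (horizontal i, 0) (dirDeriv (horizontal i, 0) (rieszKernel β)) p
      = -β * (d * rieszKernel (β + 2) p)
        + β * (β + 2) * (‖p.1‖ ^ 2 * rieszKernel (β + 4) p) := by
  simp only [dirDeriv_dirDeriv_rieszKernel β _ _ hp, prodInner_horizontal]
  rw [Finset.sum_add_distrib, ← Finset.mul_sum, ← Finset.mul_sum, ← Finset.sum_mul,
    ← Finset.sum_mul, sum_coord_sq]
  simp [horizontal]

lemma horizontalLaplacian_rieszKernel (hγ : γ = α + 3 - d) (hp : p ≠ 0) :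
    ∑ i : Fin d, dirDeriv (horizontal i, 0) (dirDeriv (horizontal i, 0) (rieszKernel α)) p
      = -α * (1 - γ) * rieszKernel (α + 2) p
        + α * (p.2 * dirDeriv (0, 1) (rieszKernel (α + 2)) p) := by
  have h1 := rieszKernel_sub_two (α + 2) hp
  rw [show α + 2 + 2 = α + 4 by ring] at h1
  rw [sum_dirDeriv_horizontal_rieszKernel α hp, dirDeriv_vertical_rieszKernel _ hp,
    show α + 2 + 2 = α + 4 by ring, hγ]
  linear_combination (-α * (α + 2)) * h1

lemma weightedLaplacian_rieszKernel (hγ : γ = α + 3 - d) (hp : p ≠ 0) :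
    ∑ i : Fin d, p.2 * (p.2 *
        dirDeriv (horizontal i, 0) (dirDeriv (horizontal i, 0) (rieszKernel (α + 2))) p)
      = -1 * (p.2 * (p.2 * dirDeriv (0, 1) (dirDeriv (0, 1) (rieszKernel (α + 2))) p))
        + -γ * (p.2 * dirDeriv (0, 1) (rieszKernel (α + 2)) p) := by
  have h1 := rieszKernel_sub_two (α + 4) hp
  rw [show α + 4 + 2 = α + 6 by ring] at h1
  rw [← Finset.mul_sum, ← Finset.mul_sum, sum_dirDeriv_horizontal_rieszKernel _ hp,
    dirDeriv_vertical_vertical_rieszKernel _ hp, dirDeriv_vertical_rieszKernel _ hp,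
    dirDeriv_vertical_rieszKernel _ hp, show α + 2 + 2 = α + 4 by ring,
    show α + 2 + 4 = α + 6 by ring, show α + 4 + 2 = α + 6 by ring, hγ]
  linear_combination (-(α + 2) * (α + 4) * p.2 ^ 2) * h1

lemma hessSq_Kext (hα : 0 ≤ α) (hμ : Continuous μ) (hμs : HasCompactSupport μ)
    (hp : 0 < p.2) :
    hessSq d (Kext d α μ) p = ∑ i : Fin (d + 1), ∑ j : Fin (d + 1),
      potential μ (dirDeriv (dir d i) (dirDeriv (dir d j) (rieszKernel α))) p
        * potential μ (dirDeriv (dir d i) (dirDeriv (dir d j) (rieszKernel α))) p := by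
  refine Finset.sum_congr rfl fun i _ => Finset.sum_congr rfl fun j _ => ?_
  rw [← (isHomKernel_rieszKernel α).dirDeriv_dirDeriv_potential hα hμ hμs _ _ hp, ← sq]
  rfl

lemma dgamma_Kext (hα : 0 ≤ α) (hγ : γ = α + 3 - d) (hμ : Continuous μ)
    (hμs : HasCompactSupport μ) (hp : 0 < p.2) :
    dgamma d γ (Kext d α μ) p = -2 * α * potential μ (rieszKernel (α + 2)) p := by
  have hk := isHomKernel_rieszKernel (E := EuclideanSpace ℝ (Fin d)) α
  have hk2 := isHomKernel_rieszKernel (E := EuclideanSpace ℝ (Fin d)) (α + 2)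
  have hd2 : IsHomKernel (α + 2) (fun q : EuclideanSpace ℝ (Fin d) × ℝ =>
      q.2 * dirDeriv (0, 1) (rieszKernel (α + 2)) q) :=
    (hk2.isHomKernel_dirDeriv _).snd_mul.of_eq (by ring)
  have e : dgamma d γ (Kext d α μ) p
      = (∑ i : Fin d, dirDeriv (horizontal i, 0) (dirDeriv (horizontal i, 0)
            (potential μ (rieszKernel α))) p)
        + dirDeriv (0, 1) (dirDeriv (0, 1) (potential μ (rieszKernel α))) p
        + γ / p.2 * dirDeriv (0, 1) (potential μ (rieszKernel α)) p := rfl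
  rw [e, hk.dirDeriv_potential hα hμ hμs _ hp]
  simp only [hk.dirDeriv_dirDeriv_potential hα hμ hμs _ _ hp]
  rw [← IsHomKernel.potential_sum Finset.univ (fun i =>
    (hk.isHomKernel_dirDeriv (horizontal i, 0)).isHomKernel_dirDeriv (horizontal i, 0)) hμ hμs hp,
    potential_congr (fun q hq => horizontalLaplacian_rieszKernel hγ hq) hp,
    potential_congr (fun q hq => dirDeriv_vertical_vertical_rieszKernel α hq) hp,
    potential_congr (fun q hq => dirDeriv_vertical_rieszKernel α hq) hp,
    (hk2.const_mul _).potential_add (hd2.const_mul _) hμ hμs hp, potential_const_mul,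
    potential_const_mul, potential_const_mul, hk2.potential_add hd2 hμ hμs hp,
    potential_const_mul, potential_snd_mul, potential_snd_mul]
  field_simp
  ring

end Coordinates

section Identity

variable {d : ℕ} {α γ : ℝ} {μ : EuclideanSpace ℝ (Fin d) → ℝ}

lemma snd_mul_dirDeriv_vertical_snd_mul {ψ : EuclideanSpace ℝ (Fin d) × ℝ → ℝ}
    {p : EuclideanSpace ℝ (Fin d) × ℝ} (h : DifferentiableAt ℝ ψ p) :
    p.2 * dirDeriv (0, 1) (fun q => q.2 * ψ q) p
      = p.2 * ψ p + p.2 * (p.2 * dirDeriv (0, 1) ψ p) := by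
  have h1 : fderiv ℝ (fun q : EuclideanSpace ℝ (Fin d) × ℝ => q.2 * ψ q) p
      = p.2 • fderiv ℝ ψ p + ψ p • ContinuousLinearMap.snd ℝ _ ℝ :=
    (hasFDerivAt_snd.fun_mul h.hasFDerivAt).fderiv
  simp only [dirDeriv, h1]
  simp
  ring

lemma admissibleExponents (hα₁ : max 0 ((d : ℝ) - 4) < α) (hα₂ : α < (d : ℝ) - 2)
    (hγ : γ = α + 3 - d) :
    AdmissibleExponents (Module.finrank ℝ (EuclideanSpace ℝ (Fin d))) (α + 2) γ := by
  obtain ⟨h0, h4⟩ := max_lt_iff.1 hα₁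
  have hf : (Module.finrank ℝ (EuclideanSpace ℝ (Fin d)) : ℝ) = d := by
    rw [finrank_euclideanSpace_fin]
  constructor <;> (try rw [hf]) <;> linarith

lemma sum_energy_dir :
    ∑ i : Fin (d + 1), ∑ j : Fin (d + 1),
        energy γ μ (dirDeriv (dir d i) (dirDeriv (dir d j) (rieszKernel α)))
          (dirDeriv (dir d i) (dirDeriv (dir d j) (rieszKernel α)))
      = (∑ i : Fin d, ∑ j : Fin d,
          energy γ μ (dirDeriv (horizontal i, 0) (dirDeriv (horizontal j, 0) (rieszKernel α)))
            (dirDeriv (horizontal i, 0) (dirDeriv (horizontal j, 0) (rieszKernel α))))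
        + 2 * (∑ i : Fin d,
          energy γ μ (dirDeriv (horizontal i, 0) (dirDeriv (0, 1) (rieszKernel α)))
            (dirDeriv (horizontal i, 0) (dirDeriv (0, 1) (rieszKernel α))))
        + energy γ μ (dirDeriv (0, 1) (dirDeriv (0, 1) (rieszKernel α)))
            (dirDeriv (0, 1) (dirDeriv (0, 1) (rieszKernel α))) := by
  have hc : ∀ j : Fin d,
      energy γ μ (dirDeriv (0, 1) (dirDeriv (horizontal j, 0) (rieszKernel α)))
          (dirDeriv (0, 1) (dirDeriv (horizontal j, 0) (rieszKernel α)))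
        = energy γ μ (dirDeriv (horizontal j, 0) (dirDeriv (0, 1) (rieszKernel α)))
          (dirDeriv (horizontal j, 0) (dirDeriv (0, 1) (rieszKernel α))) := fun j =>
    energy_congr (fun p hp => (isHomKernel_rieszKernel α).dirDeriv_comm _ _ hp)
      (fun p hp => (isHomKernel_rieszKernel α).dirDeriv_comm _ _ hp)
  simp only [Fin.sum_univ_castSucc, dir_castSucc, dir_last, Finset.sum_add_distrib, hc]
  ring

variable [Nontrivial (EuclideanSpace ℝ (Fin d))]
  (hA : AdmissibleExponents (Module.finrank ℝ (EuclideanSpace ℝ (Fin d))) (α + 2) γ)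
  (hγ : γ = α + 3 - d) (hμ : Continuous μ) (hμs : HasCompactSupport μ)

include hA hμ hμs

lemma integral_hessSq_Kext (hα : 0 ≤ α) :
    ∫ p in {p : EuclideanSpace ℝ (Fin d) × ℝ | 0 < p.2}, p.2 ^ γ * hessSq d (Kext d α μ) p
      = ∑ i : Fin (d + 1), ∑ j : Fin (d + 1),
        energy γ μ (dirDeriv (dir d i) (dirDeriv (dir d j) (rieszKernel α)))
          (dirDeriv (dir d i) (dirDeriv (dir d j) (rieszKernel α))) := by
  have hk : ∀ i j, IsHomKernel (α + 2)
      (dirDeriv (dir d i) (dirDeriv (dir d j) (rieszKernel α))) := fun i j =>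
    (((isHomKernel_rieszKernel α).isHomKernel_dirDeriv _).isHomKernel_dirDeriv _).of_eq (by ring)
  have hi := fun i j => (hk i j).integrableOn_energy hA hμ hμs (hk i j)
  simp only [energy]
  simp_rw [← integral_finsetSum Finset.univ fun j _ => hi _ j]
  rw [← integral_finsetSum Finset.univ fun i _ =>
    integrable_finsetSum Finset.univ fun j _ => hi i j]
  refine setIntegral_congr_fun isOpen_upperHalf.measurableSet fun p hp => ?_
  simp only [hessSq_Kext hα hμ hμs hp, Finset.mul_sum]

include hγ

lemma sum_energy_horizontal_horizontal (hα : 0 ≤ α) :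
    ∑ i : Fin d, ∑ j : Fin d,
        energy γ μ (dirDeriv (horizontal i, 0) (dirDeriv (horizontal j, 0) (rieszKernel α)))
          (dirDeriv (horizontal i, 0) (dirDeriv (horizontal j, 0) (rieszKernel α)))
      = α ^ 2 * ((1 - γ) ^ 2 * energy γ μ (rieszKernel (α + 2)) (rieszKernel (α + 2))
        - 2 * (1 - γ) * energy γ μ (rieszKernel (α + 2))
            (fun p => p.2 * dirDeriv (0, 1) (rieszKernel (α + 2)) p)
        + energy γ μ (fun p => p.2 * dirDeriv (0, 1) (rieszKernel (α + 2)) p)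
            (fun p => p.2 * dirDeriv (0, 1) (rieszKernel (α + 2)) p)) := by
  have hk := isHomKernel_rieszKernel (E := EuclideanSpace ℝ (Fin d)) α
  have h2 := isHomKernel_rieszKernel (E := EuclideanSpace ℝ (Fin d)) (α + 2)
  have h3 : IsHomKernel (α + 2) (fun p : EuclideanSpace ℝ (Fin d) × ℝ =>
      p.2 * dirDeriv (0, 1) (rieszKernel (α + 2)) p) :=
    (h2.isHomKernel_dirDeriv _).snd_mul.of_eq (by ring)
  have hii : ∀ i : Fin d, IsHomKernel (α + 2)
      (dirDeriv (horizontal i, 0) (dirDeriv (horizontal i, 0) (rieszKernel α))) := fun i =>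
    ((hk.isHomKernel_dirDeriv _).isHomKernel_dirDeriv _).of_eq (by ring)
  simp_rw [energy_dirDeriv_dirDeriv_swap hA hμ hμs (hk.of_eq (by ring)) (by linarith)]
  simp_rw [← energy_sum_right hA hμ hμs Finset.univ (hii _) hii]
  rw [← energy_sum_left hA hμ hμs Finset.univ hii (IsHomKernel.sum _ hii),
    energy_congr (fun p hp => horizontalLaplacian_rieszKernel hγ hp)
      (fun p hp => horizontalLaplacian_rieszKernel hγ hp),
    energy_add_left hA hμ hμs (h2.const_mul _) (h3.const_mul _)
      ((h2.const_mul _).add (h3.const_mul _)),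
    energy_add_right hA hμ hμs (h2.const_mul _) (h2.const_mul _) (h3.const_mul _),
    energy_add_right hA hμ hμs (h3.const_mul _) (h2.const_mul _) (h3.const_mul _)]
  simp only [energy_const_mul_left, energy_const_mul_right]
  rw [energy_comm (φ := fun p => p.2 * dirDeriv (0, 1) (rieszKernel (α + 2)) p)
    (ψ := rieszKernel (α + 2))]
  ring

lemma sum_energy_horizontal_vertical :
    ∑ i : Fin d,
        energy γ μ (dirDeriv (horizontal i, 0) (dirDeriv (0, 1) (rieszKernel α)))
          (dirDeriv (horizontal i, 0) (dirDeriv (0, 1) (rieszKernel α)))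
      = α ^ 2 * (energy γ μ (rieszKernel (α + 2))
          (fun p => p.2 * (p.2 * dirDeriv (0, 1) (dirDeriv (0, 1) (rieszKernel (α + 2))) p))
        + γ * energy γ μ (rieszKernel (α + 2))
            (fun p => p.2 * dirDeriv (0, 1) (rieszKernel (α + 2)) p)) := by
  have h2 := isHomKernel_rieszKernel (E := EuclideanSpace ℝ (Fin d)) (α + 2)
  have h3 : IsHomKernel (α + 2) (fun p : EuclideanSpace ℝ (Fin d) × ℝ =>
      p.2 * dirDeriv (0, 1) (rieszKernel (α + 2)) p) :=
    (h2.isHomKernel_dirDeriv _).snd_mul.of_eq (by ring)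
  have h4 : ∀ v, IsHomKernel (α + 2) (fun p : EuclideanSpace ℝ (Fin d) × ℝ =>
      p.2 * (p.2 * dirDeriv v (dirDeriv v (rieszKernel (α + 2))) p)) := fun v =>
    ((h2.isHomKernel_dirDeriv v).isHomKernel_dirDeriv v).snd_mul.snd_mul.of_eq (by ring)
  have e : ∀ i : Fin d,
      energy γ μ (dirDeriv (horizontal i, 0) (dirDeriv (0, 1) (rieszKernel α)))
          (dirDeriv (horizontal i, 0) (dirDeriv (0, 1) (rieszKernel α)))
        = -α ^ 2 * energy γ μ (rieszKernel (α + 2)) (fun p => p.2 * (p.2 *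
          dirDeriv (horizontal i, 0) (dirDeriv (horizontal i, 0) (rieszKernel (α + 2))) p)) :=
    fun i => by
    rw [energy_congr (fun p hp => dirDeriv_horizontal_vertical_rieszKernel α i hp)
      (fun p hp => dirDeriv_horizontal_vertical_rieszKernel α i hp), energy_const_mul_left,
      energy_const_mul_right, energy_snd_mul_dirDeriv hA hμ hμs h2]
    ring
  simp only [e]
  rw [← Finset.mul_sum, ← energy_sum_right hA hμ hμs Finset.univ h2 fun i => h4 _,
    energy_congr (fun _ _ => rfl) (fun p hp => weightedLaplacian_rieszKernel hγ hp),
    energy_add_right hA hμ hμs h2 ((h4 _).const_mul _) (h3.const_mul _),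
    energy_const_mul_right, energy_const_mul_right]
  ring

omit hγ

lemma energy_vertical_vertical :
    energy γ μ (dirDeriv (0, 1) (dirDeriv (0, 1) (rieszKernel α)))
        (dirDeriv (0, 1) (dirDeriv (0, 1) (rieszKernel α)))
      = α ^ 2 * (energy γ μ (rieszKernel (α + 2)) (rieszKernel (α + 2))
        + 2 * energy γ μ (rieszKernel (α + 2))
            (fun p => p.2 * dirDeriv (0, 1) (rieszKernel (α + 2)) p)
        + energy γ μ (fun p => p.2 * dirDeriv (0, 1) (rieszKernel (α + 2)) p)
            (fun p => p.2 * dirDeriv (0, 1) (rieszKernel (α + 2)) p)) := by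
  have h2 := isHomKernel_rieszKernel (E := EuclideanSpace ℝ (Fin d)) (α + 2)
  have h3 : IsHomKernel (α + 2) (fun p : EuclideanSpace ℝ (Fin d) × ℝ =>
      p.2 * dirDeriv (0, 1) (rieszKernel (α + 2)) p) :=
    (h2.isHomKernel_dirDeriv _).snd_mul.of_eq (by ring)
  rw [energy_congr (fun p hp => dirDeriv_vertical_vertical_rieszKernel α hp)
      (fun p hp => dirDeriv_vertical_vertical_rieszKernel α hp), energy_const_mul_left,
    energy_const_mul_right, energy_add_left hA hμ hμs h2 h3 (h2.add h3),
    energy_add_right hA hμ hμs h2 h2 h3, energy_add_right hA hμ hμs h3 h2 h3,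
    energy_comm (φ := fun p => p.2 * dirDeriv (0, 1) (rieszKernel (α + 2)) p)
      (ψ := rieszKernel (α + 2))]
  ring

lemma energy_rieszKernel_relations :
    (γ + 1) * energy γ μ (rieszKernel (α + 2)) (rieszKernel (α + 2))
        + 2 * energy γ μ (rieszKernel (α + 2))
            (fun p => p.2 * dirDeriv (0, 1) (rieszKernel (α + 2)) p) = 0 ∧
      (γ + 2) * energy γ μ (rieszKernel (α + 2))
          (fun p => p.2 * dirDeriv (0, 1) (rieszKernel (α + 2)) p)
        + energy γ μ (fun p => p.2 * dirDeriv (0, 1) (rieszKernel (α + 2)) p)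
            (fun p => p.2 * dirDeriv (0, 1) (rieszKernel (α + 2)) p)
        + energy γ μ (rieszKernel (α + 2)) (fun p =>
            p.2 * (p.2 * dirDeriv (0, 1) (dirDeriv (0, 1) (rieszKernel (α + 2))) p)) = 0 := by
  have h2 := isHomKernel_rieszKernel (E := EuclideanSpace ℝ (Fin d)) (α + 2)
  have h2' := h2.isHomKernel_dirDeriv (0, 1)
  have h3 : IsHomKernel (α + 2) (fun p : EuclideanSpace ℝ (Fin d) × ℝ =>
      p.2 * dirDeriv (0, 1) (rieszKernel (α + 2)) p) := h2'.snd_mul.of_eq (by ring)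
  have h4 : IsHomKernel (α + 2) (fun p : EuclideanSpace ℝ (Fin d) × ℝ =>
      p.2 * (p.2 * dirDeriv (0, 1) (dirDeriv (0, 1) (rieszKernel (α + 2))) p)) :=
    (h2'.isHomKernel_dirDeriv _).snd_mul.snd_mul.of_eq (by ring)
  constructor
  · have h := energy_scaling hA hμ hμs h2 h2
    rw [energy_comm (φ := fun p => p.2 * dirDeriv (0, 1) (rieszKernel (α + 2)) p)
      (ψ := rieszKernel (α + 2))] at h
    linarith
  · have h := energy_scaling hA hμ hμs h2 h3
    rw [energy_congr (φ := rieszKernel (α + 2)) (fun _ _ => rfl) (fun p hp =>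
        snd_mul_dirDeriv_vertical_snd_mul (h2'.differentiableAt hp)),
      energy_add_right hA hμ hμs h2 h3 h4] at h
    linarith

end Identity

/-- For `d ≥ 3`, `α ∈ (max(0,d-4), d-2)` and `γ = α + 3 - d`, the extended
potential `𝒦 = 𝒦_{μ,α}` of any `μ ∈ C_c^∞(ℝ^d)` satisfies
`∬ ξ^γ |∇²_{(x,ξ)} 𝒦|² dx dξ = (1 - γ/4) ∬ ξ^γ |Δ_γ 𝒦|² dx dξ`. -/
theorem stmt_8 (d : ℕ) (hd : 3 ≤ d) (α γ : ℝ)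
    (hα₁ : max 0 ((d : ℝ) - 4) < α) (hα₂ : α < (d : ℝ) - 2)
    (hγ : γ = α + 3 - d)
    (μ : EuclideanSpace ℝ (Fin d) → ℝ)
    (hμ : ContDiff ℝ (⊤ : ℕ∞) μ) (hμs : HasCompactSupport μ) :
    ∫ p in {p : EuclideanSpace ℝ (Fin d) × ℝ | 0 < p.2},
        p.2 ^ γ * hessSq d (Kext d α μ) p
      = (1 - γ / 4) * ∫ p in {p : EuclideanSpace ℝ (Fin d) × ℝ | 0 < p.2},
          p.2 ^ γ * (dgamma d γ (Kext d α μ) p) ^ 2 := by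
  have hα : 0 ≤ α := (max_lt_iff.1 hα₁).1.le
  have hA := admissibleExponents hα₁ hα₂ hγ
  have hμc := hμ.continuous
  have : Nonempty (Fin d) := ⟨⟨0, by omega⟩⟩
  obtain ⟨r1, r2⟩ := energy_rieszKernel_relations hA hμc hμs
  have hR : ∫ p in {p : EuclideanSpace ℝ (Fin d) × ℝ | 0 < p.2},
        p.2 ^ γ * (dgamma d γ (Kext d α μ) p) ^ 2
      = 4 * α ^ 2 * energy γ μ (rieszKernel (α + 2)) (rieszKernel (α + 2)) := by
    rw [energy, ← integral_const_mul]
    refine setIntegral_congr_fun isOpen_upperHalf.measurableSet fun p hp => ?_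
    simp only [dgamma_Kext hα hγ hμc hμs hp]
    ring
  rw [integral_hessSq_Kext hA hμc hμs hα, sum_energy_dir,
    sum_energy_horizontal_horizontal hA hγ hμc hμs hα,
    sum_energy_horizontal_vertical hA hγ hμc hμs, energy_vertical_vertical hA hμc hμs, hR]
  linear_combination 2 * α ^ 2 * r2 + α ^ 2 * (γ - 2) * r1
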